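/- arXiv:0905.2013 — 2 statements merged into one kernel-verified Lean document; each statement's English description precedes it below -/
import Mathlib

section
/- Let n, k be nonnegative integers with n ≥ 2k. Then the number of permutations w of {1,…,n} such that w(1) < w(2) < ⋯ < w(n−k) and the longest increasing subsequence of w has length exactly n−k is equal to ∑_{r=0}^{k} (−1)^{k−r} · C(k,r) · n!/(n−r)!. -/
open Polynomial

/-- `w` has an increasing subsequence of length `m`. -/
def HasIncSubseq {n : ℕ} (w : Equiv.Perm (Fin n)) (m : ℕ) : Prop :=
  ∃ f : Fin m → Fin n, StrictMono f ∧ StrictMono fun j => w (f j)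

/-- The length of the longest increasing subsequence of `w`. -/
noncomputable def isLen {n : ℕ} (w : Equiv.Perm (Fin n)) : ℕ :=
  sSup {m | HasIncSubseq w m}

/-- The first `n - s` values of `w` are increasing (positions `0,…,n-s-1` in 0-indexing,
i.e. `w(1) < ⋯ < w(n-s)` in 1-indexing). -/
def PrefixInc (n s : ℕ) (w : Equiv.Perm (Fin n)) : Prop :=
  ∀ i j : Fin n, (i : ℕ) < j → (j : ℕ) < n - s → w i < w j

/-- Major index of a permutation: the sum of the (1-indexed) descent positions.
Position `i ∈ {0,…,n-2}` (0-indexed) contributes `i + 1`. -/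
def maj {n : ℕ} (σ : Equiv.Perm (Fin n)) : ℕ :=
  ∑ i ∈ Finset.range n,
    if h : i + 1 < n then
      if σ ⟨i + 1, h⟩ < σ ⟨i, Nat.lt_of_succ_lt h⟩ then i + 1 else 0
    else 0

/-- The q-integer `[m]_q = 1 + q + ⋯ + q^{m-1}` as a polynomial in `q = X` over `ℤ`. -/
noncomputable def qInt (m : ℕ) : Polynomial ℤ :=
  ∑ i ∈ Finset.range m, (X : Polynomial ℤ) ^ i

/-- The set `Π_{n,k}` of permutations whose first `n - k` values are increasing and whose
longest increasing subsequence has length exactly `n - k`, as a `Finset`. -/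
noncomputable def PiFinset (n k : ℕ) : Finset (Equiv.Perm (Fin n)) :=
  @Finset.filter _ (fun w => PrefixInc n k w ∧ isLen w = n - k) (Classical.decPred _)
    Finset.univ

/-- The set `C_{n,s}` of permutations whose first `n - s` values are increasing,
as a `Finset`. -/
noncomputable def CFinset (n s : ℕ) : Finset (Equiv.Perm (Fin n)) :=
  @Finset.filter _ (fun w => PrefixInc n s w) (Classical.decPred _) Finset.univ

/-- The prefix `w(1),…,w(a)` (1-indexed) contains an increasing subsequence of length `m`. -/
def HasIncSubseqPrefix {n : ℕ} (w : Equiv.Perm (Fin n)) (a m : ℕ) : Prop :=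
  ∃ f : Fin m → Fin n, StrictMono f ∧ (∀ j, (f j : ℕ) < a) ∧ StrictMono fun j => w (f j)

/-- Membership in `C_{n,s,a}`: `π ∈ C_{n,s}`, the prefix of length `a` contains an increasing
subsequence of length `n - s + 1`, but the prefix of length `a - 1` does not. -/
def MemCa (n s a : ℕ) (π : Equiv.Perm (Fin n)) : Prop :=
  PrefixInc n s π ∧ HasIncSubseqPrefix π a (n - s + 1) ∧
    ¬ HasIncSubseqPrefix π (a - 1) (n - s + 1)

/-- The set `C_{n,s,a}` as a `Finset`. -/
noncomputable def CaFinset (n s a : ℕ) : Finset (Equiv.Perm (Fin n)) :=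
  @Finset.filter _ (fun π => MemCa n s a π) (Classical.decPred _) Finset.univ

section RowInsertion

variable {α : Type*} [LinearOrder α]

/-- Row insertion of `x` into the row `p.1`; the bumped letters are recorded in `p.2`, the most
recent one first. -/
def bump (x : α) (p : Finset α × List α) : Finset α × List α :=
  if h : (p.1.filter (x < ·)).Nonempty then
    (insert x (p.1.erase ((p.1.filter (x < ·)).min' h)), (p.1.filter (x < ·)).min' h :: p.2)
  else (insert x p.1, p.2)

/-- The result of inserting the letters of `l`, read from right to left, into the row `R`. -/
def insertAll (R : Finset α) (l : List α) : Finset α × List α :=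
  l.foldr bump (R, [])

@[simp] theorem insertAll_nil (R : Finset α) : insertAll R [] = (R, []) := rfl

@[simp] theorem insertAll_cons (R : Finset α) (x : α) (l : List α) :
    insertAll R (x :: l) = bump x (insertAll R l) := rfl

/-- The row and the list of bumped letters do not share or repeat letters. -/
def IsGood (p : Finset α × List α) : Prop :=
  p.2.Nodup ∧ ∀ x ∈ p.1, x ∉ p.2

/-- The letters of `b` can be put back into the row `R`, one after the other, by undoing bumps. -/
def IsValid : Finset α → List α → Prop
  | _, [] => True
  | R, y :: b => ∃ h : (R.filter (· < y)).Nonempty,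
      IsValid (insert y (R.erase ((R.filter (· < y)).max' h))) b

theorem bump_eq_or (x : α) (p : Finset α × List α) :
    (∃ y ∈ p.1, x < y ∧ (∀ z ∈ p.1, x < z → y ≤ z) ∧
      bump x p = (insert x (p.1.erase y), y :: p.2)) ∨
    ((∀ z ∈ p.1, z ≤ x) ∧ bump x p = (insert x p.1, p.2)) := by
  by_cases h : (p.1.filter (x < ·)).Nonempty
  · left
    have hm := Finset.min'_mem _ h
    rw [Finset.mem_filter] at hm
    refine ⟨_, hm.1, hm.2, fun z hz hxz => Finset.min'_le _ _ (by simp [hz, hxz]), ?_⟩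
    rw [bump, dif_pos h]
  · right
    refine ⟨fun z hz => ?_, by rw [bump, dif_neg h]⟩
    by_contra! hxz
    exact h ⟨z, by simp [hz, hxz]⟩

theorem bump_of_least {x y : α} {p : Finset α × List α} (hy : y ∈ p.1) (hxy : x < y)
    (hmin : ∀ z ∈ p.1, x < z → y ≤ z) : bump x p = (insert x (p.1.erase y), y :: p.2) := by
  obtain ⟨z, hz, hxz, hzmin, h⟩ | ⟨h, -⟩ := bump_eq_or x p
  · rw [h, le_antisymm (hmin z hz hxz) (hzmin y hy hxy)]
  · exact absurd (h y hy) (not_le.2 hxy)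

theorem bump_of_forall_le {x : α} {p : Finset α × List α} (h : ∀ z ∈ p.1, z ≤ x) :
    bump x p = (insert x p.1, p.2) := by
  obtain ⟨z, hz, hxz, -⟩ | ⟨-, h⟩ := bump_eq_or x p
  · exact absurd (h z hz) (not_le.2 hxz)
  · exact h

theorem mem_bump {x z : α} {p : Finset α × List α} :
    z ∈ (bump x p).1 ∨ z ∈ (bump x p).2 ↔ z = x ∨ z ∈ p.1 ∨ z ∈ p.2 := by
  obtain ⟨y, hy, -, -, h⟩ | ⟨-, h⟩ := bump_eq_or x p
  · rw [h]
    simp only [Finset.mem_insert, Finset.mem_erase, List.mem_cons]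
    grind
  · rw [h]
    simp only [Finset.mem_insert, or_assoc]

theorem IsGood.bump {x : α} {p : Finset α × List α} (hp : IsGood p) (hx : x ∉ p.2) :
    IsGood (bump x p) := by
  obtain ⟨hn, hd⟩ := hp
  obtain ⟨y, hy, hxy, -, h⟩ | ⟨-, h⟩ := bump_eq_or x p
  · rw [h]
    refine ⟨List.nodup_cons.2 ⟨hd y hy, hn⟩, fun z hz => ?_⟩
    simp only [Finset.mem_insert, Finset.mem_erase, List.mem_cons] at hz ⊢
    grind
  · rw [h]
    refine ⟨hn, fun z hz => ?_⟩
    simp only [Finset.mem_insert] at hz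
    grind

theorem mem_insertAll {R : Finset α} {l : List α} {z : α} :
    z ∈ (insertAll R l).1 ∨ z ∈ (insertAll R l).2 ↔ z ∈ R ∨ z ∈ l := by
  induction l with
  | nil => simp
  | cons x l ih => rw [insertAll_cons, mem_bump, ih, List.mem_cons]; tauto

theorem isGood_insertAll {R : Finset α} {l : List α} (h : IsGood (R, l)) :
    IsGood (insertAll R l) := by
  induction l with
  | nil => exact h
  | cons x l ih =>
    obtain ⟨hn, hd⟩ := h
    simp only [List.nodup_cons, List.mem_cons, not_or] at hn hd
    refine (ih ⟨hn.2, fun z hz => (hd z hz).2⟩).bump fun hx => ?_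
    obtain h | h := mem_insertAll.1 (Or.inr hx)
    · exact (hd x h).1 rfl
    · exact hn.1 h

theorem length_insertAll_le (R : Finset α) (l : List α) : (insertAll R l).2.length ≤ l.length := by
  induction l with
  | nil => simp
  | cons x l ih =>
    rw [insertAll_cons]
    obtain ⟨y, -, -, -, h⟩ | ⟨-, h⟩ := bump_eq_or x (insertAll R l) <;> rw [h] <;> simp <;> omega

/-- The rows `R` and `R'` have the same `j` smallest elements. -/
def Agree (j : ℕ) (R R' : Finset α) : Prop :=
  ∃ t, j ≤ (R.filter (· < t)).card ∧ R.filter (· < t) = R'.filter (· < t)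

theorem Agree.symm {j : ℕ} {R R' : Finset α} (h : Agree j R R') : Agree j R' R := by
  obtain ⟨t, ht, e⟩ := h
  exact ⟨t, e ▸ ht, e.symm⟩

theorem Agree.exists_lt {j : ℕ} {R R' : Finset α} (h : Agree (j + 1) R R') {y : α}
    (hy : (R.filter (· < y)).Nonempty) : (R'.filter (· < y)).Nonempty := by
  obtain ⟨t, ht, e⟩ := h
  obtain ⟨z, hz⟩ := hy
  obtain ⟨u, hu⟩ := Finset.card_pos.1 (Nat.lt_of_lt_of_le j.succ_pos ht)
  have hu' := e ▸ hu
  simp only [Finset.mem_filter] at hz hu hu'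
  obtain hyt | hyt := lt_or_ge y t
  · have : z ∈ R.filter (· < t) := by simp [hz.1, hz.2.trans hyt]
    rw [e, Finset.mem_filter] at this
    exact ⟨z, by simp [this.1, hz.2]⟩
  · exact ⟨u, by simp [hu'.1, hu.2.trans_le hyt]⟩

theorem Agree.unbump {j : ℕ} {R R' : Finset α} (h : Agree (j + 1) R R') {y : α}
    (hy : (R.filter (· < y)).Nonempty) (hy' : (R'.filter (· < y)).Nonempty) (hyR : y ∉ R) :
    Agree j (insert y (R.erase ((R.filter (· < y)).max' hy)))
      (insert y (R'.erase ((R'.filter (· < y)).max' hy'))) := by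
  obtain ⟨t, ht, e⟩ := h
  have hm := Finset.max'_mem _ hy
  have hm' := Finset.max'_mem _ hy'
  have hmax := fun z => Finset.le_max' (R.filter (· < y)) z
  have hmax' := fun z => Finset.le_max' (R'.filter (· < y)) z
  set x := (R.filter (· < y)).max' hy
  set x' := (R'.filter (· < y)).max' hy'
  have he : ∀ z, z < t → (z ∈ R ↔ z ∈ R') := fun z hz => by
    have := Finset.ext_iff.1 e z
    simpa [hz] using this
  simp only [Finset.mem_filter] at hm hm' hmax hmax'
  obtain hyt | hyt := lt_or_ge y t
  · have hxx : x = x' := by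
      apply le_antisymm
      · exact hmax' x ⟨(he x (hm.2.trans hyt)).1 hm.1, hm.2⟩
      · exact hmax x' ⟨(he x' (hm'.2.trans hyt)).2 hm'.1, hm'.2⟩
    refine ⟨t, ?_, ?_⟩
    · rw [Finset.filter_insert, if_pos hyt, Finset.filter_erase, Finset.card_insert_of_notMem,
        Finset.card_erase_of_mem]
      · omega
      · simp [hm.1, hm.2.trans hyt]
      · simp [hyR]
    · rw [Finset.filter_insert, if_pos hyt, Finset.filter_insert, if_pos hyt,
        Finset.filter_erase, Finset.filter_erase, e, hxx]
  · have hne := Finset.card_pos.1 (Nat.lt_of_lt_of_le j.succ_pos ht)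
    have hs := Finset.max'_mem _ hne
    have hsmax := fun z => Finset.le_max' (R.filter (· < t)) z
    set s := (R.filter (· < t)).max' hne
    simp only [Finset.mem_filter] at hs hsmax
    have hsx : s ≤ x := hmax s ⟨hs.1, hs.2.trans_le hyt⟩
    have hsx' : s ≤ x' := hmax' s ⟨(he s hs.2).1 hs.1, hs.2.trans_le hyt⟩
    have key : ∀ (Q : Finset α) (v : α), s ≤ v →
        (insert y (Q.erase v)).filter (· < s) = Q.filter (· < s) := fun Q v hv => by
      ext z
      simp only [Finset.mem_filter, Finset.mem_insert, Finset.mem_erase]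
      have : s < y := hs.2.trans_le hyt
      grind
    refine ⟨s, ?_, ?_⟩
    · rw [key R x hsx]
      have hsub : R.filter (· < t) ⊆ insert s (R.filter (· < s)) := fun z hz => by
        simp only [Finset.mem_filter, Finset.mem_insert] at hz ⊢
        have := hsmax z hz
        grind
      have := (Finset.card_le_card hsub).trans (Finset.card_insert_le _ _)
      omega
    · rw [key R x hsx, key R' x' hsx']
      ext z
      simp only [Finset.mem_filter]
      have := he z
      have := hs.2
      grind

theorem IsValid.of_agree {b : List α} : ∀ {R R' : Finset α}, Agree b.length R R' →
    IsGood (R, b) → IsValid R b → IsValid R' b := by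
  induction b with
  | nil => exact fun _ _ _ => trivial
  | cons y b ih =>
    rintro R R' h ⟨hn, hd⟩ ⟨hy, hv⟩
    simp only [List.nodup_cons, List.mem_cons, not_or] at hn hd
    refine ⟨h.exists_lt hy, ih (h.unbump hy _ fun hyR => (hd y hyR).1 rfl) ⟨hn.2, ?_⟩ hv⟩
    simp only [Finset.mem_insert, Finset.mem_erase]
    rintro z (rfl | hz)
    · exact hn.1
    · exact (hd z hz.2).2

theorem isValid_erase_max {R : Finset α} {b : List α} (hg : IsGood (R, b)) (hR : R.Nonempty)
    (hb : b.length < R.card) : IsValid (R.erase (R.max' hR)) b ↔ IsValid R b := by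
  have hf : R.filter (· < R.max' hR) = R.erase (R.max' hR) := by
    ext z
    simp only [Finset.mem_filter, Finset.mem_erase]
    have := Finset.le_max' R z
    grind
  have h : Agree b.length R (R.erase (R.max' hR)) := by
    refine ⟨R.max' hR, ?_, ?_⟩
    · rw [hf, Finset.card_erase_of_mem (Finset.max'_mem _ _)]
      omega
    · ext z
      simp only [Finset.mem_filter, Finset.mem_erase]
      grind
  exact ⟨IsValid.of_agree h.symm ⟨hg.1, fun z hz => hg.2 z (Finset.mem_of_mem_erase hz)⟩,
    IsValid.of_agree h hg⟩

theorem bump_max {R : Finset α} (hR : R.Nonempty) (b : List α) :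
    bump (R.max' hR) (R.erase (R.max' hR), b) = (R, b) := by
  rw [bump_of_forall_le]
  · simp [Finset.insert_erase (R.max'_mem hR)]
  · exact fun z hz => R.le_max' z (Finset.mem_of_mem_erase hz)

theorem bump_unbump {R : Finset α} {y : α} (hy : (R.filter (· < y)).Nonempty) (hyR : y ∉ R)
    (b : List α) : bump ((R.filter (· < y)).max' hy)
      (insert y (R.erase ((R.filter (· < y)).max' hy)), b) = (R, y :: b) := by
  have hm := Finset.max'_mem _ hy
  have hmax := fun z => Finset.le_max' (R.filter (· < y)) z
  set x := (R.filter (· < y)).max' hy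
  simp only [Finset.mem_filter] at hm hmax
  rw [bump_of_least (y := y) (by simp) hm.2]
  · rw [Finset.erase_insert (by simp [hyR]), Finset.insert_erase hm.1]
  · simp only [Finset.mem_insert, Finset.mem_erase]
    grind

theorem eq_of_bump_eq {x : α} {p : Finset α × List α} (hg : IsGood p) (hx : x ∉ p.1)
    {R : Finset α} (hR : R.Nonempty) {b : List α} (h : bump x p = (R, b)) :
    (x = R.max' hR ∧ p = (R.erase (R.max' hR), b)) ∨
    ∃ y b', b = y :: b' ∧ ∃ hy : (R.filter (· < y)).Nonempty,
      x = (R.filter (· < y)).max' hy ∧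
        p = (insert y (R.erase ((R.filter (· < y)).max' hy)), b') := by
  obtain ⟨P, c⟩ := p
  obtain ⟨y, hy, hxy, hmin, e⟩ | ⟨hle, e⟩ := bump_eq_or x (P, c)
  · right
    simp only at hy hmin e hx
    obtain ⟨rfl, rfl⟩ := Prod.mk.inj (h.symm.trans e)
    have hne : ((insert x (P.erase y)).filter (· < y)).Nonempty := ⟨x, by simp [hxy]⟩
    have hmx : x = ((insert x (P.erase y)).filter (· < y)).max' hne := by
      refine le_antisymm (Finset.le_max' _ _ (by simp [hxy])) (Finset.max'_le _ _ _ fun z hz => ?_)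
      simp only [Finset.mem_filter, Finset.mem_insert, Finset.mem_erase] at hz
      have := hmin z
      grind
    refine ⟨y, c, rfl, hne, hmx, ?_⟩
    rw [← hmx, Finset.erase_insert (by simp [hx]), Finset.insert_erase hy]
  · left
    simp only at hle e hx
    obtain ⟨rfl, rfl⟩ := Prod.mk.inj (h.symm.trans e)
    have hmx : x = (insert x P).max' hR := by
      refine le_antisymm (Finset.le_max' _ _ (by simp)) (Finset.max'_le _ _ _ fun z hz => ?_)
      rw [Finset.mem_insert] at hz
      exact hz.elim le_of_eq (hle z)
    rw [← hmx, Finset.erase_insert hx]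
    exact ⟨rfl, rfl⟩

/-- The pairs of a starting row and a word of length `k` whose insertion ends with row `R` and
bumped letters `b`. -/
def words (k : ℕ) (R : Finset α) (b : List α) : Set (Finset α × List α) :=
  {p | p.2.length = k ∧ IsGood p ∧ insertAll p.1 p.2 = (R, b)}

theorem mem_words_succ {k : ℕ} {R : Finset α} {b : List α} (hg : IsGood (R, b))
    (hR : R.Nonempty) {p : Finset α × List α} : p ∈ words (k + 1) R b ↔
      (∃ q ∈ words k (R.erase (R.max' hR)) b, (q.1, R.max' hR :: q.2) = p) ∨
      ∃ y b', b = y :: b' ∧ ∃ hy : (R.filter (· < y)).Nonempty,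
        ∃ q ∈ words k (insert y (R.erase ((R.filter (· < y)).max' hy))) b',
          (q.1, (R.filter (· < y)).max' hy :: q.2) = p := by
  obtain ⟨P, l⟩ := p
  constructor
  · rintro ⟨hl, ⟨hn, hd⟩, he⟩
    obtain _ | ⟨x, l⟩ := l
    · simp at hl
    simp only [List.nodup_cons, List.mem_cons, not_or, List.length_cons, insertAll_cons,
      Nat.add_right_cancel_iff] at hn hd hl he
    have hg' : IsGood (P, l) := ⟨hn.2, fun z hz => (hd z hz).2⟩
    have hx : x ∉ (insertAll P l).1 := fun hx => by
      obtain h | h := mem_insertAll.1 (Or.inl hx)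
      · exact (hd x h).1 rfl
      · exact hn.1 h
    obtain ⟨rfl, h⟩ | ⟨y, b', rfl, hy, rfl, h⟩ := eq_of_bump_eq (isGood_insertAll hg') hx hR he
    · exact Or.inl ⟨(P, l), ⟨hl, hg', h⟩, rfl⟩
    · exact Or.inr ⟨y, b', rfl, hy, (P, l), ⟨hl, hg', h⟩, rfl⟩
  · have key : ∀ x Q m, x ∉ (insertAll Q m).1 → x ∉ (insertAll Q m).2 → m.length = k →
        IsGood (Q, m) → bump x (insertAll Q m) = (R, b) → (Q, x :: m) ∈ words (k + 1) R b := by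
      intro x Q m h1 h2 hm hg' he
      have h : ¬ (x ∈ Q ∨ x ∈ m) := fun h => (mem_insertAll.2 h).elim h1 h2
      push Not at h
      refine ⟨by simp [hm], ⟨by simp [h.2, hg'.1], fun z hz => ?_⟩, he⟩
      rw [List.mem_cons, not_or]
      exact ⟨fun e => h.1 (e ▸ hz), hg'.2 z hz⟩
    rintro (⟨⟨Q, m⟩, ⟨hm, hg', he⟩, h⟩ | ⟨y, b', rfl, hy, ⟨Q, m⟩, ⟨hm, hg', he⟩, h⟩)
    · rw [← h]
      refine key _ _ _ ?_ ?_ hm hg' ?_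
      · simp [he]
      · rw [he]
        exact hg.2 _ (R.max'_mem hR)
      · rw [he, bump_max]
    · obtain ⟨hn, hd⟩ := hg
      simp only [List.nodup_cons, List.mem_cons, not_or] at hn hd
      have hmem := (Finset.mem_filter.1 (Finset.max'_mem _ hy))
      rw [← h]
      refine key _ _ _ ?_ ?_ hm hg' ?_
      · simp only [he, Finset.mem_insert, Finset.mem_erase]
        exact fun h => h.elim hmem.2.ne fun h => h.1 rfl
      · rw [he]
        exact (hd _ hmem.1).2
      · rw [he, bump_unbump _ fun hyR => (hd y hyR).1 rfl]

open Classical in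
theorem ncard_words [Finite α] {k : ℕ} : ∀ {R : Finset α} {b : List α}, IsGood (R, b) →
    k ≤ R.card → (words k R b).ncard = if IsValid R b then k.choose b.length else 0 := by
  have hfin : ∀ k (R : Finset α) (b : List α), (words k R b).Finite := fun k R b =>
    (Set.finite_univ.prod (List.finite_length_eq α k)).subset fun p hp => ⟨trivial, hp.1⟩
  have hinj : ∀ x : α, Function.Injective
      fun q : Finset α × List α => (q.1, x :: q.2) := by
    rintro x ⟨Q, m⟩ ⟨Q', m'⟩ h
    simpa using h
  induction k with
  | zero =>
    rintro R (_ | ⟨y, b⟩) hg -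
    · have : words 0 R [] = {(R, [])} := by
        ext ⟨Q, m⟩
        simp only [words, Set.mem_ofPred_eq, Set.mem_singleton_iff, List.length_eq_zero_iff]
        constructor
        · rintro ⟨rfl, -, h⟩
          simpa using h
        · intro h
          obtain ⟨rfl, rfl⟩ := Prod.mk.inj h
          exact ⟨rfl, hg, rfl⟩
      simp [this, IsValid]
    · have : words 0 R (y :: b) = ∅ := by
        ext ⟨Q, m⟩
        simp only [words, Set.mem_ofPred_eq, Set.mem_empty_iff_false, List.length_eq_zero_iff]
        refine ⟨?_, False.elim⟩
        rintro ⟨rfl, -, h⟩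
        simp at h
      simp [this]
  | succ k ih =>
    intro R b hg hk
    have hR : R.Nonempty := Finset.card_pos.1 (k.succ_pos.trans_le hk)
    have hg₁ : IsGood (R.erase (R.max' hR), b) :=
      ⟨hg.1, fun z hz => hg.2 z (Finset.mem_of_mem_erase hz)⟩
    have hv : (if IsValid (R.erase (R.max' hR)) b then k.choose b.length else 0) =
        if IsValid R b then k.choose b.length else 0 := by
      obtain hb | hb := lt_or_ge b.length R.card
      · simp only [isValid_erase_max hg hR hb]
      · simp [Nat.choose_eq_zero_of_lt (show k < b.length by omega)]
    have h₁ := ih hg₁ (by rw [Finset.card_erase_of_mem (R.max'_mem hR)]; omega)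
    by_cases hb : ∃ y b', b = y :: b' ∧ (R.filter (· < y)).Nonempty
    · obtain ⟨y, b, rfl, hy⟩ := hb
      have hmem := (Finset.mem_filter.1 (Finset.max'_mem _ hy))
      obtain ⟨hn, hd⟩ := id hg
      simp only [List.nodup_cons, List.mem_cons, not_or] at hn hd
      have hyR : y ∉ R := fun hyR => (hd y hyR).1 rfl
      have hw : words (k + 1) R (y :: b) =
          (fun q => (q.1, R.max' hR :: q.2)) '' words k (R.erase (R.max' hR)) (y :: b) ∪
          (fun q => (q.1, (R.filter (· < y)).max' hy :: q.2)) ''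
            words k (insert y (R.erase ((R.filter (· < y)).max' hy))) b := by
        ext p
        rw [mem_words_succ hg hR]
        simp only [Set.mem_union, Set.mem_image]
        refine or_congr_right ⟨?_, fun h => ⟨y, b, rfl, hy, h⟩⟩
        rintro ⟨y', b', h, hy', h'⟩
        obtain ⟨rfl, rfl⟩ := List.cons.inj h
        exact h'
      have hg₂ : IsGood (insert y (R.erase ((R.filter (· < y)).max' hy)), b) := by
        refine ⟨hn.2, fun z hz => ?_⟩
        simp only [Finset.mem_insert, Finset.mem_erase] at hz
        grind
      have h₂ := ih hg₂ (by
        rw [Finset.card_insert_of_notMem (by simp [hyR]), Finset.card_erase_of_mem hmem.1]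
        omega)
      have hvalid : IsValid (insert y (R.erase ((R.filter (· < y)).max' hy))) b ↔
          IsValid R (y :: b) := ⟨fun h => ⟨hy, h⟩, fun ⟨_, h⟩ => h⟩
      rw [hw, Set.ncard_union_eq ?_ ((hfin _ _ _).image _) ((hfin _ _ _).image _),
        Set.ncard_image_of_injective _ (hinj _), Set.ncard_image_of_injective _ (hinj _),
        h₁, h₂, hv]
      · by_cases hV : IsValid R (y :: b)
        · rw [if_pos hV, if_pos hV, if_pos (hvalid.2 hV), List.length_cons,
            Nat.choose_succ_succ, add_comm]
        · rw [if_neg hV, if_neg hV, if_neg (mt hvalid.1 hV)]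
      · rw [Set.disjoint_left]
        rintro - ⟨⟨Q, m⟩, ⟨-, -, h⟩, rfl⟩ ⟨⟨Q', m'⟩, ⟨-, -, h'⟩, e⟩
        simp only [Prod.mk.injEq, List.cons.injEq] at e h h'
        rw [e.1, e.2.2, h] at h'
        simpa using congrArg (fun p => p.2.length) h'
    · have hw : words (k + 1) R b =
          (fun q => (q.1, R.max' hR :: q.2)) '' words k (R.erase (R.max' hR)) b := by
        ext p
        rw [mem_words_succ hg hR, Set.mem_image]
        refine or_iff_left ?_
        rintro ⟨y, b', h, hy, -⟩
        exact hb ⟨y, b', h, hy⟩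
      rw [hw, Set.ncard_image_of_injective _ (hinj _), h₁, hv]
      obtain _ | ⟨y, b⟩ := b
      · simp
      · have : ¬ IsValid R (y :: b) := fun ⟨hy, _⟩ => hb ⟨y, b, rfl, hy⟩
        simp [this]

theorem insertAll_append (R : Finset α) (l l' : List α) :
    insertAll R (l ++ l') = l.foldr bump (insertAll R l') :=
  List.foldr_append

theorem insertAll_of_pairwise_gt {l : List α} (h : l.Pairwise (· > ·)) :
    insertAll ∅ l = (l.toFinset, []) := by
  induction l with
  | nil => simp
  | cons x l ih =>
    rw [List.pairwise_cons] at h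
    rw [insertAll_cons, ih h.2, bump_of_forall_le, List.toFinset_cons]
    exact fun z hz => (h.1 z (List.mem_toFinset.1 hz)).le

theorem card_filter_bump (D : α → Prop) [DecidablePred D] (hD : ∀ x y, x ≤ y → D y → D x)
    {x : α} {p : Finset α × List α} (hx : x ∉ p.1) :
    ((bump x p).1.filter D).card =
      if D x then max (p.1.filter D).card ((p.1.filter (· < x)).card + 1)
      else (p.1.filter D).card := by
  obtain ⟨R, b⟩ := p
  have lt_subset : D x → R.filter (· < x) ⊆ R.filter D := fun hDx z hz => by
    rw [Finset.mem_filter] at hz ⊢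
    exact ⟨hz.1, hD z x hz.2.le hDx⟩
  have subset_lt (h : ∀ z ∈ R, D z → z ≤ x) : R.filter D ⊆ R.filter (· < x) := fun z hz => by
    rw [Finset.mem_filter] at hz ⊢
    exact ⟨hz.1, (h z hz.1 hz.2).lt_of_ne fun e => hx (e ▸ hz.1)⟩
  obtain ⟨y, hy, hxy, hmin, e⟩ | ⟨hle, e⟩ := bump_eq_or x (R, b)
  · simp only at hy hmin hx
    simp only [e, Finset.filter_insert, Finset.filter_erase]
    by_cases hDx : D x
    · rw [if_pos hDx, if_pos hDx, Finset.card_insert_of_notMem (by simp [hx])]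
      by_cases hDy : D y
      · have hy' : y ∈ R.filter D := by simp [hy, hDy]
        have hlt : (R.filter (· < x)).card < (R.filter D).card := by
          refine Finset.card_lt_card ⟨lt_subset hDx, fun h => ?_⟩
          exact (Finset.mem_filter.1 (h hy')).2.not_gt hxy
        rw [Finset.card_erase_add_one hy']
        omega
      · have : R.filter D = R.filter (· < x) := by
          refine (subset_lt fun z hz hDz => ?_).antisymm (lt_subset hDx)
          by_contra! h
          exact hDy (hD y z (hmin z hz h) hDz)
        rw [Finset.erase_eq_of_notMem (by simp [hDy]), this]
        omega
    · have hDy : ¬ D y := fun h => hDx (hD x y hxy.le h)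
      rw [if_neg hDx, if_neg hDx, Finset.erase_eq_of_notMem (by simp [hDy])]
  · simp only at hle hx
    simp only [e, Finset.filter_insert]
    split_ifs with hDx
    · have : R.filter D = R.filter (· < x) :=
        (subset_lt fun z hz _ => hle z hz).antisymm (lt_subset hDx)
      rw [Finset.card_insert_of_notMem (by simp [hx]), this]
      omega
    · rfl

theorem notMem_insertAll_of_nodup {x : α} {l : List α} (h : (x :: l).Nodup) :
    x ∉ (insertAll ∅ l).1 := fun hx => by
  obtain h' | h' := mem_insertAll.1 (Or.inl hx)
  · simp at h'
  · exact (List.nodup_cons.1 h).1 h'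

theorem length_le_card_insertAll {l : List α} (hl : l.Nodup) :
    ∀ (D : α → Prop) [DecidablePred D], (∀ x y, x ≤ y → D y → D x) →
      ∀ c : List α, c.Sublist l → c.Pairwise (· > ·) → (∀ x ∈ c, D x) →
        c.length ≤ ((insertAll ∅ l).1.filter D).card := by
  induction l with
  | nil =>
    intro D _ _ c hc _ _
    simp [List.sublist_nil.1 hc]
  | cons x l ih =>
    intro D _ hD c hc hp hcD
    have ih := @ih (List.nodup_cons.1 hl).2
    rw [insertAll_cons, card_filter_bump D hD (notMem_insertAll_of_nodup hl)]
    obtain hc | ⟨c, rfl, hc'⟩ := List.sublist_cons_iff.1 hc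
    · have := ih D hD c hc hp hcD
      split_ifs <;> omega
    · rw [List.pairwise_cons] at hp
      have := ih (· < x) (fun a b h h' => h.trans_lt h') c hc' hp.2 hp.1
      rw [if_pos (hcD x (by simp)), List.length_cons]
      omega

theorem exists_sublist_length_eq_card {l : List α} (hl : l.Nodup) :
    ∀ (D : α → Prop) [DecidablePred D], (∀ x y, x ≤ y → D y → D x) →
      ∃ c : List α, c.Sublist l ∧ c.Pairwise (· > ·) ∧ (∀ x ∈ c, D x) ∧
        c.length = ((insertAll ∅ l).1.filter D).card := by
  induction l with
  | nil =>
    intro D _ _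
    exact ⟨[], by simp⟩
  | cons x l ih =>
    intro D _ hD
    have ih := @ih (List.nodup_cons.1 hl).2
    rw [insertAll_cons, card_filter_bump D hD (notMem_insertAll_of_nodup hl)]
    obtain ⟨c, hc, hp, hcD, hlen⟩ := ih D hD
    obtain ⟨c', hc', hp', hcx, hlen'⟩ := ih (· < x) fun a b h h' => h.trans_lt h'
    by_cases h : D x ∧
        ((insertAll ∅ l).1.filter D).card ≤ ((insertAll ∅ l).1.filter (· < x)).card
    · refine ⟨x :: c', hc'.cons_cons x, List.pairwise_cons.2 ⟨hcx, hp'⟩, fun z hz => ?_, ?_⟩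
      · obtain rfl | hz := List.mem_cons.1 hz
        · exact h.1
        · exact hD z x (hcx z hz).le h.1
      · rw [if_pos h.1, List.length_cons]
        omega
    · refine ⟨c, hc.cons x, hp, hcD, ?_⟩
      split_ifs with hDx
      · have : ¬ _ := fun h' => h ⟨hDx, h'⟩
        omega
      · exact hlen

theorem fst_eq_compl [Fintype α] {p : Finset α × List α} (hp : IsGood p)
    (h : ∀ z, z ∈ p.1 ∨ z ∈ p.2) : p.1 = p.2.toFinsetᶜ := by
  ext z
  rw [Finset.mem_compl, List.mem_toFinset]
  exact ⟨hp.2 z, (h z).resolve_right⟩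

theorem isGood_compl [Fintype α] {l : List α} (hl : l.Nodup) : IsGood (l.toFinsetᶜ, l) :=
  ⟨hl, fun z hz => by simpa using hz⟩

/-- The letters bumped when the letters of `l`, read from right to left, are inserted into the row
formed by the letters that do not occur in `l`. -/
def bumped [Fintype α] (l : List α) : List α :=
  (insertAll l.toFinsetᶜ l).2

theorem nodup_bumped [Fintype α] {l : List α} (hl : l.Nodup) : (bumped l).Nodup :=
  (isGood_insertAll (isGood_compl hl)).1

theorem insertAll_compl_eq [Fintype α] {l : List α} (hl : l.Nodup) :
    insertAll l.toFinsetᶜ l = ((bumped l).toFinsetᶜ, bumped l) := by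
  refine Prod.ext (fst_eq_compl (isGood_insertAll (isGood_compl hl)) fun z => ?_) rfl
  rw [mem_insertAll]
  simp [or_comm, em]

end RowInsertion

section Counting

/-- The lists of length `k` without repeated entries. -/
noncomputable def nodupLists (n k : ℕ) : Finset (List (Fin n)) :=
  Finset.univ.image fun f : Fin k ↪ Fin n => List.ofFn f

theorem mem_nodupLists {n k : ℕ} {l : List (Fin n)} :
    l ∈ nodupLists n k ↔ l.Nodup ∧ l.length = k := by
  simp only [nodupLists, Finset.mem_image, Finset.mem_univ, true_and]
  constructor
  · rintro ⟨f, rfl⟩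
    exact ⟨List.nodup_ofFn.2 f.injective, List.length_ofFn⟩
  · rintro ⟨h, rfl⟩
    exact ⟨⟨l.get, List.nodup_iff_injective_get.1 h⟩, List.ofFn_get l⟩

theorem card_nodupLists (n k : ℕ) : (nodupLists n k).card = n.descFactorial k := by
  rw [nodupLists, Finset.card_image_of_injective]
  · simp [Fintype.card_embedding_eq]
  · exact fun f g h => DFunLike.coe_injective (List.ofFn_injective h)

theorem card_fiber_bumped {n k s : ℕ} {b : List (Fin n)} (hb : b ∈ nodupLists n s) :
    ((nodupLists n k).filter (bumped · = b)).card = (words k b.toFinsetᶜ b).ncard := by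
  rw [mem_nodupLists] at hb
  have hinj : Function.Injective fun l : List (Fin n) => (l.toFinsetᶜ, l) :=
    fun l l' h => (Prod.mk.inj h).2
  rw [← Set.ncard_coe_finset, ← Set.ncard_image_of_injective _ hinj]
  congr 1
  ext ⟨Q, m⟩
  simp only [Set.mem_image, Finset.mem_coe, Finset.mem_filter, mem_nodupLists, words,
    Set.mem_ofPred_eq, Prod.mk.injEq]
  constructor
  · rintro ⟨l, ⟨⟨hl, rfl⟩, rfl⟩, rfl, rfl⟩
    exact ⟨rfl, isGood_compl hl, insertAll_compl_eq hl⟩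
  · rintro ⟨rfl, hg, h⟩
    have hQ : Q = m.toFinsetᶜ := fst_eq_compl hg fun z => by
      rw [← mem_insertAll, h]
      simp [or_comm, em]
    subst hQ
    exact ⟨m, ⟨⟨hg.1, rfl⟩, congrArg Prod.snd h⟩, rfl, rfl⟩

open Classical in
theorem card_length_bumped_eq {n k s : ℕ} (h : s + k ≤ n) :
    ((nodupLists n k).filter fun l => (bumped l).length = s).card =
      k.choose s * ((nodupLists n s).filter fun b => IsValid b.toFinsetᶜ b).card := by
  rw [Finset.card_eq_sum_card_fiberwise (f := bumped) (t := nodupLists n s)]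
  · rw [Finset.card_filter, Finset.mul_sum]
    refine Finset.sum_congr rfl fun b hb => ?_
    have hb' := mem_nodupLists.1 hb
    rw [Finset.filter_filter, mul_ite, mul_one, mul_zero, ← hb'.2,
      ← ncard_words (isGood_compl hb'.1), ← card_fiber_bumped hb]
    · congr 1
      ext l
      simp only [Finset.mem_filter]
      grind
    · rw [Finset.card_compl, List.toFinset_card_of_nodup hb'.1, Fintype.card_fin]
      omega
  · intro l hl
    simp only [Finset.coe_filter, Set.mem_ofPred_eq, mem_nodupLists, Finset.mem_coe] at hl ⊢
    exact ⟨nodup_bumped hl.1.1, hl.2⟩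

theorem length_bumped_le {n : ℕ} (l : List (Fin n)) : (bumped l).length ≤ l.length :=
  length_insertAll_le _ _

open Classical in
theorem descFactorial_eq_sum {n k : ℕ} (h : 2 * k ≤ n) :
    n.descFactorial k = ∑ s ∈ Finset.range (k + 1),
      k.choose s * ((nodupLists n s).filter fun b => IsValid b.toFinsetᶜ b).card := by
  rw [← card_nodupLists, Finset.card_eq_sum_card_fiberwise (f := fun l => (bumped l).length)
    (t := Finset.range (k + 1))]
  · refine Finset.sum_congr rfl fun s hs => card_length_bumped_eq ?_
    have := Finset.mem_range.1 hs
    omega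
  · intro l hl
    have := length_bumped_le l
    have := (mem_nodupLists.1 hl).2
    simp only [Finset.coe_range, Set.mem_Iio]
    omega

/-- Binomial inversion. -/
theorem eq_sum_of_eq_sum_choose {f g : ℕ → ℤ} {N : ℕ}
    (h : ∀ k ≤ N, f k = ∑ s ∈ Finset.range (k + 1), (k.choose s : ℤ) * g s) :
    ∀ k ≤ N, g k = ∑ r ∈ Finset.range (k + 1), (-1) ^ (k - r) * (k.choose r : ℤ) * f r := by
  intro k
  induction k using Nat.strong_induction_on with
  | _ k ih =>
    intro hk
    have key : ∀ j, (fwdDiff 1)^[j] f 0 =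
        ∑ r ∈ Finset.range (j + 1), (-1) ^ (j - r) * (j.choose r : ℤ) * f r := fun j => by
      simp [fwdDiff_iter_eq_sum_shift]
    have h₁ := h k hk
    have h₂ := shift_eq_sum_fwdDiff_iter 1 f k 0
    rw [Finset.sum_range_succ] at h₁ h₂
    rw [Finset.sum_congr rfl fun s hs => by
      rw [ih s (Finset.mem_range.1 hs) ((Finset.mem_range.1 hs).le.trans hk), ← key]] at h₁
    rw [← key]
    simp only [zero_add, smul_eq_mul, mul_one, Nat.choose_self, Nat.cast_one, one_mul,
      nsmul_eq_mul] at h₁ h₂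
    linarith

end Counting

section Permutations

variable {n k : ℕ}

theorem hasIncSubseq_iff (w : Equiv.Perm (Fin n)) (m : ℕ) :
    HasIncSubseq w m ↔
      ∃ c : List (Fin n), c.Sublist (List.ofFn w).reverse ∧ c.Pairwise (· > ·) ∧ c.length = m := by
  constructor
  · rintro ⟨f, hf, hwf⟩
    refine ⟨((List.ofFn f).map w).reverse, ?_, ?_, by simp⟩
    · rw [List.reverse_sublist, List.ofFn_eq_map (f := w)]
      refine List.Sublist.map w (List.sublist_of_subperm_of_pairwise (r := (· < ·)) ?_
        (List.pairwise_ofFn.2 fun i j h => hf h) (List.pairwise_lt_finRange n))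
      exact List.subperm_of_subset (List.nodup_ofFn.2 hf.injective) fun x _ => List.mem_finRange x
    · rw [List.pairwise_reverse, List.map_ofFn, List.pairwise_ofFn]
      exact fun i j h => hwf h
  · rintro ⟨c, hc, hp, rfl⟩
    obtain ⟨l, hl, h⟩ := List.sublist_map_iff.1 (List.ofFn_eq_map (f := w) ▸
      (List.reverse_sublist.1 (by rwa [List.reverse_reverse]) : c.reverse.Sublist (List.ofFn w)))
    have hlen : c.length = l.length := by simpa using congrArg List.length h
    rw [← List.reverse_reverse c, List.pairwise_reverse, h, List.pairwise_map] at hp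
    rw [hlen]
    exact ⟨l.get, fun i j => List.pairwise_iff_get.1 ((List.pairwise_lt_finRange n).sublist hl) i j,
      fun i j => List.pairwise_iff_get.1 hp i j⟩

theorem isLen_eq (w : Equiv.Perm (Fin n)) :
    isLen w = (insertAll ∅ (List.ofFn w).reverse).1.card := by
  have hn : (List.ofFn w).reverse.Nodup := List.nodup_reverse.2 (List.nodup_ofFn.2 w.injective)
  refine IsGreatest.csSup_eq ⟨?_, fun m hm => ?_⟩
  · obtain ⟨c, hc, hp, -, hlen⟩ := exists_sublist_length_eq_card hn (fun _ => True) (by simp)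
    exact (hasIncSubseq_iff w _).2 ⟨c, hc, hp, by simpa using hlen⟩
  · obtain ⟨c, hc, hp, rfl⟩ := (hasIncSubseq_iff w m).1 hm
    simpa using length_le_card_insertAll hn (fun _ => True) (by simp) c hc hp (by simp)

/-- The last `k` values of `w`, in reverse order. -/
def suffix (k : ℕ) (w : Equiv.Perm (Fin n)) : List (Fin n) :=
  ((List.ofFn w).drop (n - k)).reverse

theorem suffix_mem_nodupLists (hk : k ≤ n) (w : Equiv.Perm (Fin n)) :
    suffix k w ∈ nodupLists n k := by
  refine mem_nodupLists.2 ⟨List.nodup_reverse.2 ?_, ?_⟩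
  · exact (List.nodup_ofFn.2 w.injective).sublist (List.drop_sublist _ _)
  · simp [suffix, Nat.sub_sub_self hk]

theorem prefixInc_iff (w : Equiv.Perm (Fin n)) :
    PrefixInc n k w ↔ ((List.ofFn w).take (n - k)).Pairwise (· < ·) := by
  simp only [List.pairwise_iff_getElem, List.getElem_take, List.getElem_ofFn, List.length_take,
    List.length_ofFn, lt_min_iff, PrefixInc]
  constructor
  · intro h i j hi hj hij
    exact h ⟨i, hi.2⟩ ⟨j, hj.2⟩ hij hj.1
  · intro h i j hij hj
    exact h i j ⟨hij.trans hj, i.2⟩ ⟨hj, j.2⟩ hij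

theorem toFinset_take (w : Equiv.Perm (Fin n)) :
    ((List.ofFn w).take (n - k)).toFinset = (suffix k w).toFinsetᶜ := by
  have hn := List.nodup_ofFn.2 w.injective
  have hm : ∀ z, z ∈ List.ofFn w := fun z => (List.mem_ofFn' _ _).2 (w.surjective z)
  rw [← List.take_append_drop (n - k) (List.ofFn w)] at hn hm
  rw [List.nodup_append] at hn
  ext z
  have := hm z
  have := hn.2.2 z
  simp only [suffix, Finset.mem_compl, List.mem_toFinset, List.mem_reverse, List.mem_append] at *
  grind

theorem insertAll_ofFn {w : Equiv.Perm (Fin n)} (hw : PrefixInc n k w) :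
    insertAll ∅ (List.ofFn w).reverse = insertAll (suffix k w).toFinsetᶜ (suffix k w) := by
  conv_lhs => rw [← List.take_append_drop (n - k) (List.ofFn w)]
  rw [List.reverse_append, insertAll_append, insertAll_of_pairwise_gt, List.toFinset_reverse,
    toFinset_take]
  · rfl
  · exact List.pairwise_reverse.2 ((prefixInc_iff w).1 hw)

theorem isLen_eq_iff (hk : k ≤ n) {w : Equiv.Perm (Fin n)} (hw : PrefixInc n k w) :
    isLen w = n - k ↔ (bumped (suffix k w)).length = k := by
  obtain ⟨hn, hl⟩ := mem_nodupLists.1 (suffix_mem_nodupLists hk w)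
  have := length_bumped_le (suffix k w)
  rw [isLen_eq, insertAll_ofFn hw, insertAll_compl_eq hn, Finset.card_compl,
    List.toFinset_card_of_nodup (nodup_bumped hn), Fintype.card_fin]
  omega

theorem suffix_injective {w w' : Equiv.Perm (Fin n)} (hw : PrefixInc n k w)
    (hw' : PrefixInc n k w') (h : suffix k w = suffix k w') : w = w' := by
  have ht : (List.ofFn w).take (n - k) = (List.ofFn w').take (n - k) := by
    refine ((prefixInc_iff w).1 hw).eq_of_mem_iff ((prefixInc_iff w').1 hw') fun z => ?_
    rw [← List.mem_toFinset, ← List.mem_toFinset, toFinset_take, toFinset_take, h]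
  have hd : (List.ofFn w).drop (n - k) = (List.ofFn w').drop (n - k) := List.reverse_injective h
  refine DFunLike.coe_injective (List.ofFn_injective ?_)
  rw [← List.take_append_drop (n - k) (List.ofFn w), ht, hd, List.take_append_drop]

theorem exists_suffix_eq {l : List (Fin n)} (hl : l ∈ nodupLists n k) :
    ∃ w : Equiv.Perm (Fin n), PrefixInc n k w ∧ suffix k w = l := by
  obtain ⟨hn, hk⟩ := mem_nodupLists.1 hl
  have hc : (l.toFinsetᶜ.sort (· ≤ ·)).length = n - k := by
    rw [Finset.length_sort, Finset.card_compl, List.toFinset_card_of_nodup hn, Fintype.card_fin, hk]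
  set L := l.toFinsetᶜ.sort (· ≤ ·) ++ l.reverse with hL
  have hLn : L.Nodup := by
    refine List.nodup_append.2 ⟨Finset.sort_nodup _ _, List.nodup_reverse.2 hn, ?_⟩
    rintro x hx _ hy rfl
    simp_all
  have hkn : k ≤ n := by
    have := hn.length_le_card
    rwa [hk, Fintype.card_fin] at this
  have hlen : L.length = n := by
    rw [hL, List.length_append, hc, List.length_reverse]
    omega
  have hinj : Function.Injective fun i : Fin n => L.get (i.cast hlen.symm) :=
    (List.nodup_iff_injective_get.1 hLn).comp (Fin.cast_injective _)
  have hw : List.ofFn (Equiv.ofBijective _ (Finite.injective_iff_bijective.1 hinj)) = L :=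
    List.ext_get (by simp [hlen]) fun i _ _ => by simp
  refine ⟨Equiv.ofBijective _ (Finite.injective_iff_bijective.1 hinj), ?_, ?_⟩
  · rw [prefixInc_iff, hw, hL, List.take_left' hc]
    exact (Finset.sortedLT_sort _).pairwise
  · rw [suffix, hw, hL, List.drop_left' hc, List.reverse_reverse]

theorem card_piFinset (hk : k ≤ n) :
    (PiFinset n k).card = ((nodupLists n k).filter fun l => (bumped l).length = k).card := by
  refine Finset.card_bij (fun w _ => suffix k w) (fun w hw => ?_) (fun w hw w' hw' => ?_)
    fun l hl => ?_
  · simp only [PiFinset, Finset.mem_filter, Finset.mem_univ, true_and] at hw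
    exact Finset.mem_filter.2 ⟨suffix_mem_nodupLists hk w, (isLen_eq_iff hk hw.1).1 hw.2⟩
  · simp only [PiFinset, Finset.mem_filter, Finset.mem_univ, true_and] at hw hw'
    exact suffix_injective hw.1 hw'.1
  · obtain ⟨hl, hb⟩ := Finset.mem_filter.1 hl
    obtain ⟨w, hw, rfl⟩ := exists_suffix_eq hl
    refine ⟨w, ?_, rfl⟩
    simp only [PiFinset, Finset.mem_filter, Finset.mem_univ, true_and]
    exact ⟨hw, (isLen_eq_iff hk hw).2 hb⟩

end Permutations

/-- Garsia--Goupil: for `n >= 2k`,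
`#Pi_{n,k} = sum_{r=0}^{k} (-1)^{k-r} C(k,r) n!/(n-r)!`,
where `n!/(n-r)! = n.descFactorial r`. -/
theorem garsia_goupil (n k : ℕ) (h : 2 * k ≤ n) :
    ((PiFinset n k).card : ℤ) =
      ∑ r ∈ Finset.range (k + 1),
        (-1) ^ (k - r) * (k.choose r : ℤ) * (n.descFactorial r : ℤ) := by
  classical
  rw [card_piFinset (by omega), card_length_bumped_eq (by omega), Nat.choose_self, one_mul]
  refine eq_sum_of_eq_sum_choose (f := fun r => (n.descFactorial r : ℤ)) (N := k)
    (g := fun s => (((nodupLists n s).filter fun b => IsValid b.toFinsetᶜ b).card : ℤ))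
    (fun j hj => ?_) k le_rfl
  rw [descFactorial_eq_sum (show 2 * j ≤ n by omega)]
  push_cast
  rfl
end

section
/- Let n, k be nonnegative integers with n ≥ 2k. Then ∑_{s=0}^{k} C(k,s) · #Π_{n,s} = C(n,k) · k! = n!/(n−k)!, where #Π_{n,s} is the number of permutations w of {1,…,n} such that w(1) < w(2) < ⋯ < w(n−s) and the longest increasing subsequence of w has length exactly n−s. -/
open Polynomial

/-- Schensted insertion into a single row: `RowInsertion W R₀ xs R bs` says that inserting the
entries of `xs`, last one first, into the row `R₀` yields the row `R`. Each insertion either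
appends (`false` in `W`) or bumps an entry (`true` in `W`), and `bs` lists the bumped entries.
The lists `W`, `xs` and `bs` all start with the most recent item. -/
inductive RowInsertion {α : Type*} [LinearOrder α] :
    List Bool → Finset α → List α → Finset α → List α → Prop
  | nil (R : Finset α) : RowInsertion [] R [] R []
  | append {W : List Bool} {R₀ R : Finset α} {xs bs : List α} {x : α}
      (h : RowInsertion W R₀ xs R bs) (hx : ∀ r ∈ R, r < x) :
      RowInsertion (false :: W) R₀ (x :: xs) (insert x R) bs
  | bump {W : List Bool} {R₀ R : Finset α} {xs bs : List α} {x b : α}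
      (h : RowInsertion W R₀ xs R bs) (hx : x ∉ R) (hb : b ∈ R) (hxb : x < b)
      (hmin : ∀ r ∈ R, x < r → b ≤ r) :
      RowInsertion (true :: W) R₀ (x :: xs) (insert x (R.erase b)) (b :: bs)

/-- The entries of `bs`, first one first, can be reverse bumped into the row `R`. -/
def ReverseBumpable {α : Type*} [LinearOrder α] : Finset α → List α → Prop
  | _, [] => True
  | R, b :: bs => ∃ x ∈ R, x < b ∧ (∀ r ∈ R, r < b → r ≤ x) ∧
      ReverseBumpable (insert b (R.erase x)) bs

/-- Reverse bumping few enough entries does not see the maximum of the row. -/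
theorem ReverseBumpable.insert_iff {α : Type*} [LinearOrder α] (bs : List α) :
    ∀ (R : Finset α) (M : α), bs.Nodup → (∀ b ∈ bs, b ∉ R) → M ∉ bs → (∀ r ∈ R, r < M) →
      bs.length ≤ R.card → (ReverseBumpable (insert M R) bs ↔ ReverseBumpable R bs) := by
  induction bs with
  | nil => intros; simp [ReverseBumpable]
  | cons b bs ih =>
    intro R M hnd hR hM hmax hcard
    simp only [List.nodup_cons, List.mem_cons, List.length_cons, not_or, forall_eq_or_imp]
      at hnd hR hM hcard
    obtain ⟨hbbs, hnd⟩ := hnd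
    obtain ⟨hbR, hR⟩ := hR
    have hMR : M ∉ R := fun h => lt_irrefl _ (hmax M h)
    rcases lt_or_gt_of_ne hM.1 with hlt | hlt
    · have hne : R.Nonempty := Finset.card_pos.mp (by omega)
      set N := R.max' hne with hN
      have hNR : N ∈ R := Finset.max'_mem _ _
      have hNle : ∀ r ∈ R, r ≤ N := fun r hr => Finset.le_max' _ _ hr
      have h1 : ReverseBumpable (insert M R) (b :: bs) ↔ ReverseBumpable (insert b R) bs := by
        constructor
        · rintro ⟨x, hx, -, hle, h⟩
          have : x = M := by
            have h1 := hle M (Finset.mem_insert_self _ _) hlt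
            rcases Finset.mem_insert.mp hx with h2 | h2
            · exact h2
            · exact absurd (hmax x h2) (not_lt.mpr h1)
          subst this
          rwa [Finset.erase_insert hMR] at h
        · intro h
          refine ⟨M, Finset.mem_insert_self _ _, hlt, ?_, ?_⟩
          · intro r hr _
            rcases Finset.mem_insert.mp hr with h2 | h2
            · exact h2.le
            · exact (hmax r h2).le
          · rwa [Finset.erase_insert hMR]
      have h2 : ReverseBumpable R (b :: bs) ↔ ReverseBumpable (insert b (R.erase N)) bs := by
        constructor
        · rintro ⟨x, hx, -, hle, h⟩
          have : x = N := le_antisymm (hNle x hx) (hle N hNR ((hmax N hNR).trans hlt))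
          rwa [this] at h
        · intro h
          exact ⟨N, hNR, (hmax N hNR).trans hlt, fun r hr _ => hNle r hr, h⟩
      have hc : (R.erase N).card + 1 = R.card := Finset.card_erase_add_one hNR
      have hR' : ∀ c ∈ bs, c ∉ R.erase N := fun c hc h => hR c hc (Finset.mem_of_mem_erase h)
      have h3 := ih R b hnd hR hbbs (fun r hr => (hmax r hr).trans hlt) (by omega)
      have h4 := ih (R.erase N) b hnd hR' hbbs
        (fun r hr => (hmax r (Finset.mem_of_mem_erase hr)).trans hlt) (by omega)
      have h5 := ih (R.erase N) N hnd hR' (fun h => hR N h hNR)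
        (fun r hr => lt_of_le_of_ne (hNle r (Finset.mem_of_mem_erase hr))
          (Finset.ne_of_mem_erase hr)) (by omega)
      rw [Finset.insert_erase hNR] at h5
      rw [h1, h2, h3, h4, h5]
    · have key : ∀ x ∈ R, x < b →
          (ReverseBumpable (insert b ((insert M R).erase x)) bs ↔
            ReverseBumpable (insert b (R.erase x)) bs) := by
        intro x hx hxb
        have hxM : M ≠ x := fun h => hMR (h ▸ hx)
        rw [Finset.erase_insert_of_ne hxM, Finset.insert_comm]
        apply ih _ _ hnd _ hM.2 _ _
        · intro c hc hmem
          rcases Finset.mem_insert.mp hmem with h | h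
          · exact hbbs (h ▸ hc)
          · exact hR c hc (Finset.mem_of_mem_erase h)
        · intro r hr
          rcases Finset.mem_insert.mp hr with h | h
          · exact h ▸ hlt
          · exact hmax r (Finset.mem_of_mem_erase h)
        · have hc : (R.erase x).card + 1 = R.card := Finset.card_erase_add_one hx
          rw [Finset.card_insert_of_notMem (fun h => hbR (Finset.mem_of_mem_erase h))]
          omega
      constructor
      · rintro ⟨x, hx, hxb, hle, h⟩
        have hxR : x ∈ R := (Finset.mem_insert.mp hx).resolve_left
          (fun h => lt_asymm (h ▸ hxb) hlt)
        exact ⟨x, hxR, hxb, fun r hr => hle r (Finset.mem_insert_of_mem hr),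
          (key x hxR hxb).mp h⟩
      · rintro ⟨x, hx, hxb, hle, h⟩
        refine ⟨x, Finset.mem_insert_of_mem hx, hxb, fun r hr hrb => ?_, (key x hx hxb).mpr h⟩
        exact hle r ((Finset.mem_insert.mp hr).resolve_left
          (fun h => lt_asymm (h ▸ hrb) hlt)) hrb

namespace RowInsertion

variable {α : Type*} [LinearOrder α] {W : List Bool} {R₀ R : Finset α}
  {xs bs : List α}

theorem val_add_eq (h : RowInsertion W R₀ xs R bs) :
    R.1 + (bs : Multiset α) = R₀.1 + (xs : Multiset α) := by
  induction h with
  | nil R => rfl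
  | append h hx ih =>
    rw [Finset.insert_val_of_notMem (fun h => lt_irrefl _ (hx _ h)), Multiset.cons_add, ih,
      ← Multiset.cons_coe, Multiset.add_cons]
  | @bump W R₀ R xs bs x b h hx hb hxb hmin ih =>
    rw [Finset.insert_val_of_notMem (fun h => hx (Finset.mem_of_mem_erase h)),
      Finset.erase_val, Multiset.cons_add, ← Multiset.cons_coe, Multiset.add_cons,
      ← Multiset.cons_add, Multiset.cons_erase (by exact hb), ih, ← Multiset.cons_coe,
      Multiset.add_cons]

theorem length_xs (h : RowInsertion W R₀ xs R bs) : xs.length = W.length := by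
  induction h <;> simp_all

theorem length_bs (h : RowInsertion W R₀ xs R bs) : bs.length = W.count true := by
  induction h <;> simp_all

theorem card_row (h : RowInsertion W R₀ xs R bs) : R.card = R₀.card + W.count false := by
  have h1 := congrArg Multiset.card h.val_add_eq
  have h2 := h.length_xs
  have h3 := h.length_bs
  have h4 := List.count_true_add_count_false W
  simp only [Multiset.card_add, Multiset.coe_card, Finset.card_val] at h1
  omega

theorem exists_of_nodup (R₀ : Finset α) (xs : List α)
    (hnd : (R₀.1 + (xs : Multiset α)).Nodup) :
    ∃ W R bs, RowInsertion W R₀ xs R bs := by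
  induction xs with
  | nil => exact ⟨_, _, _, nil R₀⟩
  | cons x xs ih =>
    rw [← Multiset.cons_coe, Multiset.add_cons, Multiset.nodup_cons] at hnd
    obtain ⟨W, R, bs, h⟩ := ih hnd.2
    have hx : x ∉ R := by
      intro hx
      apply hnd.1
      rw [← h.val_add_eq]
      exact Multiset.mem_add.mpr (Or.inl hx)
    by_cases hex : ∃ r ∈ R, x < r
    · have hne : (R.filter (x < ·)).Nonempty := by
        obtain ⟨r, hr, hxr⟩ := hex
        exact ⟨r, Finset.mem_filter.mpr ⟨hr, hxr⟩⟩
      have hmem := Finset.mem_filter.mp (Finset.min'_mem _ hne)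
      exact ⟨_, _, _, h.bump hx hmem.1 hmem.2 fun r hr hxr =>
        Finset.min'_le _ _ (Finset.mem_filter.mpr ⟨hr, hxr⟩)⟩
    · push Not at hex
      exact ⟨_, _, _, h.append fun r hr =>
        lt_of_le_of_ne (hex r hr) (fun h => hx (h ▸ hr))⟩

theorem right_unique (h : RowInsertion W R₀ xs R bs) :
    ∀ {W' R' bs'}, RowInsertion W' R₀ xs R' bs' → W = W' ∧ R = R' ∧ bs = bs' := by
  induction h with
  | nil R => intro W' R' bs' h'; cases h'; simp
  | append h hx ih =>
    intro W' R' bs' h'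
    cases h' with
    | append h' hx' =>
      obtain ⟨rfl, rfl, rfl⟩ := ih h'
      simp
    | bump h' hx' hb hxb hmin =>
      obtain ⟨rfl, rfl, rfl⟩ := ih h'
      exact absurd hxb (lt_asymm (hx _ hb))
  | bump h hx hb hxb hmin ih =>
    intro W' R' bs' h'
    cases h' with
    | append h' hx' =>
      obtain ⟨rfl, rfl, rfl⟩ := ih h'
      exact absurd hxb (lt_asymm (hx' _ hb))
    | bump h' hx' hb' hxb' hmin' =>
      obtain ⟨rfl, rfl, rfl⟩ := ih h'
      obtain rfl := le_antisymm (hmin _ hb' hxb') (hmin' _ hb hxb)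
      simp

theorem left_unique (h : RowInsertion W R₀ xs R bs) :
    ∀ {R₀' xs'}, RowInsertion W R₀' xs' R bs → xs = xs' := by
  induction h with
  | nil R => intro R₀' xs' h'; cases h'; rfl
  | @append W R₀ R xs bs x h hx ih =>
    intro R₀' xs' h'
    generalize hQ : insert x R = Q at h'
    cases h' with
    | @append _ _ R' xs' _ x' h' hx' =>
      have hxx : x = x' := by
        have h1 : x ∈ insert x' R' := hQ ▸ Finset.mem_insert_self x R
        have h2 : x' ∈ insert x R := hQ ▸ Finset.mem_insert_self x' R'
        rcases Finset.mem_insert.mp h1 with h1 | h1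
        · exact h1
        rcases Finset.mem_insert.mp h2 with h2 | h2
        · exact h2.symm
        exact absurd (hx _ h2) (lt_asymm (hx' _ h1))
      subst hxx
      have hRR : R = R' := by
        rw [← Finset.erase_insert (fun h => lt_irrefl _ (hx _ h) : x ∉ R), hQ,
          Finset.erase_insert (fun h => lt_irrefl _ (hx' _ h))]
      subst hRR
      rw [ih h']
  | @bump W R₀ R xs bs x b h hx hb hxb hmin ih =>
    intro R₀' xs' h'
    generalize hQ : insert x (R.erase b) = Q at h'
    cases h' with
    | @bump _ _ R' xs' _ x' _ h' hx' hb' hxb' hmin' =>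
      have hxx : x = x' := by
        have h1 : x ∈ insert x' (R'.erase b) := hQ ▸ Finset.mem_insert_self x _
        have h2 : x' ∈ insert x (R.erase b) := hQ ▸ Finset.mem_insert_self x' _
        simp only [Finset.mem_insert, Finset.mem_erase] at h1 h2
        rcases h1 with h1 | h1
        · exact h1
        rcases h2 with h2 | h2
        · exact h2.symm
        rcases lt_trichotomy x x' with h3 | h3 | h3
        · exact absurd hxb' (not_lt.mpr (hmin _ h2.2 h3))
        · exact h3
        · exact absurd hxb (not_lt.mpr (hmin' _ h1.2 h3))
      subst hxx
      have hRR : R = R' := by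
        have h1 := congrArg (fun S => insert b (S.erase x)) hQ
        simpa only [Finset.erase_insert (fun h => hx (Finset.mem_of_mem_erase h)),
          Finset.erase_insert (fun h => hx' (Finset.mem_of_mem_erase h)),
          Finset.insert_erase hb, Finset.insert_erase hb'] using h1
      subst hRR
      rw [ih h']

theorem reverseBumpable (h : RowInsertion W R₀ xs R bs)
    (hnd : (R₀.1 + (xs : Multiset α)).Nodup) (hle : bs.length ≤ R₀.card) :
    ReverseBumpable R bs := by
  induction h with
  | nil R => trivial
  | @append W R₀ R xs bs x h hx ih =>
    have hnd' := hnd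
    rw [← Multiset.cons_coe, Multiset.add_cons, Multiset.nodup_cons] at hnd'
    have hV := ih hnd'.2 hle
    rw [← h.val_add_eq] at hnd'
    obtain ⟨-, h2, h3⟩ := Multiset.nodup_add.mp hnd'.2
    refine (ReverseBumpable.insert_iff bs R x (by simpa using h2) ?_ ?_ hx ?_).mpr hV
    · intro b hb hbR
      exact Multiset.disjoint_left.mp h3 hbR hb
    · intro hxb
      exact hnd'.1 (Multiset.mem_add.mpr (Or.inr hxb))
    · rw [h.card_row]; omega
  | @bump W R₀ R xs bs x b h hx hb hxb hmin ih =>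
    rw [← Multiset.cons_coe, Multiset.add_cons, Multiset.nodup_cons] at hnd
    have hV := ih hnd.2 (by simp at hle; omega)
    refine ⟨x, Finset.mem_insert_self _ _, hxb, ?_, ?_⟩
    · intro r hr hrb
      rcases Finset.mem_insert.mp hr with h1 | h1
      · exact h1.le
      · by_contra! h2
        exact absurd hrb (not_lt.mpr (hmin r (Finset.mem_of_mem_erase h1) h2))
    · rwa [Finset.erase_insert (fun h => hx (Finset.mem_of_mem_erase h)),
        Finset.insert_erase hb]

theorem exists_of_reverseBumpable (W : List Bool) : ∀ (R : Finset α) (bs : List α),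
    (R.1 + (bs : Multiset α)).Nodup → bs.length = W.count true →
      bs.length + W.count false ≤ R.card → ReverseBumpable R bs →
        ∃ R₀ xs, RowInsertion W R₀ xs R bs := by
  induction W with
  | nil =>
    intro R bs _ hlen _ _
    obtain rfl : bs = [] := by simpa using hlen
    exact ⟨_, _, nil R⟩
  | cons a W ih =>
    intro R bs hnd hlen hcard hV
    cases a with
    | false =>
      simp only [List.count_cons_self, List.count_cons, Bool.beq_eq_decide_eq, Bool.false_eq_true,
        decide_false, if_false, add_zero] at hlen hcard
      have hne : R.Nonempty := Finset.card_pos.mp (by omega)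
      set N := R.max' hne with hN
      have hNR : N ∈ R := Finset.max'_mem _ _
      have hlt : ∀ r ∈ R.erase N, r < N := fun r hr =>
        lt_of_le_of_ne (Finset.le_max' _ _ (Finset.mem_of_mem_erase hr))
          (Finset.ne_of_mem_erase hr)
      have hc : (R.erase N).card + 1 = R.card := Finset.card_erase_add_one hNR
      obtain ⟨h1, h2, h3⟩ := Multiset.nodup_add.mp hnd
      have hdisj : ∀ b ∈ bs, b ∉ R := fun b hb hbR => Multiset.disjoint_left.mp h3 hbR hb
      obtain ⟨R₀, xs, h⟩ := ih (R.erase N) bs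
        (Multiset.nodup_of_le (Multiset.add_le_add_right (Finset.val_le_iff.mpr
          (Finset.erase_subset _ _))) hnd) hlen (by omega)
        ((ReverseBumpable.insert_iff bs (R.erase N) N (by simpa using h2)
          (fun b hb h => hdisj b hb (Finset.mem_of_mem_erase h)) (fun h => hdisj N h hNR) hlt
          (by omega)).mp (by rwa [Finset.insert_erase hNR]))
      have h' := h.append hlt
      rw [Finset.insert_erase hNR] at h'
      exact ⟨_, _, h'⟩
    | true =>
      cases bs with
      | nil => simp at hlen
      | cons b bs =>
        simp only [List.count_cons_self, List.count_cons, Bool.beq_eq_decide_eq,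
          List.length_cons, reduceCtorEq,
          decide_false, if_false, add_zero, add_left_inj, Bool.false_eq_true] at hlen hcard
        obtain ⟨x, hx, hxb, hle, hV⟩ := hV
        rw [← Multiset.cons_coe, Multiset.add_cons, Multiset.nodup_cons] at hnd
        have hbR : b ∉ R := fun h => hnd.1 (Multiset.mem_add.mpr (Or.inl h))
        have hbR' : b ∉ R.erase x := fun h => hbR (Finset.mem_of_mem_erase h)
        have hc : (R.erase x).card + 1 = R.card := Finset.card_erase_add_one hx
        obtain ⟨R₀, xs, h⟩ := ih (insert b (R.erase x)) bs
          (by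
            rw [Finset.insert_val_of_notMem hbR', Multiset.cons_add, Multiset.nodup_cons]
            have hsub : (R.erase x).1 + (bs : Multiset α) ≤ R.1 + (bs : Multiset α) :=
              Multiset.add_le_add_right (Finset.val_le_iff.mpr (Finset.erase_subset _ _))
            exact ⟨fun h => hnd.1 (Multiset.mem_of_le hsub h),
              Multiset.nodup_of_le hsub hnd.2⟩)
          hlen (by rw [Finset.card_insert_of_notMem hbR']; omega) hV
        have h' := h.bump (x := x) (b := b) (by simp [hxb.ne]) (Finset.mem_insert_self _ _) hxb
          (by
            intro r hr hxr
            rcases Finset.mem_insert.mp hr with h1 | h1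
            · exact h1.ge
            · by_contra! h2
              exact absurd hxr (not_lt.mpr (hle r (Finset.mem_of_mem_erase h1) h2)))
        rw [Finset.erase_insert hbR', Finset.insert_erase hx] at h'
        exact ⟨_, _, h'⟩

end RowInsertion

namespace RowInsertion

variable {α : Type*} [LinearOrder α] {W : List Bool} {R₀ R : Finset α}
  {xs bs l₀ : List α}

open List in
theorem length_le_card_filter (h : RowInsertion W l₀.toFinset xs R bs) :
    ∀ (v : α) (l : List α), l <+ xs ++ l₀ → l.Pairwise (· > ·) → (∀ a ∈ l, a ≤ v) →
      l.length ≤ (R.filter (· ≤ v)).card := by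
  generalize hR : l₀.toFinset = R₀ at h
  have cons_step : ∀ {R R' : Finset α} {L : List α} {x : α},
      (∀ (v : α) (l : List α), l <+ L → l.Pairwise (· > ·) → (∀ a ∈ l, a ≤ v) →
        l.length ≤ (R.filter (· ≤ v)).card) →
      x ∈ R' → (∀ r ∈ R, r < x → r ∈ R') →
      ∀ (v : α) (l : List α), l <+ L → (x :: l).Pairwise (· > ·) → x ≤ v →
        (x :: l).length ≤ (R'.filter (· ≤ v)).card := by
    intro R R' L x ih hx hlow v l hl hp hxv
    cases l with
    | nil => exact Finset.card_pos.mpr ⟨x, Finset.mem_filter.mpr ⟨hx, hxv⟩⟩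
    | cons c t =>
      rw [List.pairwise_cons] at hp
      have hcx : c < x := hp.1 c (by simp)
      have h1 := ih c (c :: t) hl hp.2 (by
        intro a ha
        rcases List.mem_cons.mp ha with h | h
        · exact h.le
        · exact ((List.pairwise_cons.mp hp.2).1 a h).le)
      have h2 : insert x (R.filter (· ≤ c)) ⊆ R'.filter (· ≤ v) := by
        intro r hr
        simp only [Finset.mem_insert, Finset.mem_filter] at hr ⊢
        rcases hr with rfl | ⟨hr, hrc⟩
        · exact ⟨hx, hxv⟩
        · exact ⟨hlow r hr (hrc.trans_lt hcx), (hrc.trans_lt hcx).le.trans hxv⟩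
      have h3 := Finset.card_le_card h2
      rw [Finset.card_insert_of_notMem (by simp [hcx])] at h3
      rw [List.length_cons]
      omega
  induction h with
  | nil R =>
    intro v l hl hp hv
    rw [← List.toFinset_card_of_nodup (hp.imp fun h => ne_of_gt h)]
    apply Finset.card_le_card
    intro a ha
    rw [List.mem_toFinset] at ha
    rw [Finset.mem_filter, ← hR, List.mem_toFinset]
    exact ⟨hl.subset ha, hv a ha⟩
  | @append W R₀ R xs bs x h hx ih =>
    intro v l hl hp hv
    rcases List.sublist_cons_iff.mp hl with hl' | ⟨l, rfl, hl'⟩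
    · exact (ih hR v l hl' hp hv).trans (Finset.card_le_card
        (Finset.filter_subset_filter _ (Finset.subset_insert _ _)))
    · exact cons_step (ih hR) (Finset.mem_insert_self _ _)
        (fun r hr _ => Finset.mem_insert_of_mem hr) v l hl' hp (hv x (by simp))
  | @bump W R₀ R xs bs x b h hx hb hxb hmin ih =>
    intro v l hl hp hv
    rcases List.sublist_cons_iff.mp hl with hl' | ⟨l, rfl, hl'⟩
    · refine (ih hR v l hl' hp hv).trans ?_
      by_cases hbv : b ≤ v
      · rw [Finset.filter_insert, if_pos (hxb.le.trans hbv), Finset.filter_erase,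
          Finset.card_insert_of_notMem (by simp [hx]),
          Finset.card_erase_add_one (Finset.mem_filter.mpr ⟨hb, hbv⟩)]
      · apply Finset.card_le_card
        intro r hr
        simp only [Finset.mem_insert, Finset.mem_filter, Finset.mem_erase] at hr ⊢
        exact ⟨Or.inr ⟨fun h => hbv (h ▸ hr.2), hr.1⟩, hr.2⟩
    · exact cons_step (ih hR) (Finset.mem_insert_self _ _)
        (fun r hr hrx => Finset.mem_insert_of_mem
          (Finset.mem_erase.mpr ⟨(hrx.trans hxb).ne, hr⟩)) v l hl' hp (hv x (by simp))

open List in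
theorem exists_card_filter_le_length (h : RowInsertion W l₀.toFinset xs R bs)
    (h₀ : l₀.Pairwise (· > ·)) :
    ∀ v : α, ∃ l : List α, l <+ xs ++ l₀ ∧ l.Pairwise (· > ·) ∧ (∀ a ∈ l, a ≤ v) ∧
      (R.filter (· ≤ v)).card ≤ l.length := by
  generalize hR : l₀.toFinset = R₀ at h
  have cons_step : ∀ {R R' : Finset α} {L : List α} {x v : α},
      (∀ v : α, ∃ l : List α, l <+ L ∧ l.Pairwise (· > ·) ∧ (∀ a ∈ l, a ≤ v) ∧
        (R.filter (· ≤ v)).card ≤ l.length) →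
      x ≤ v → R'.filter (· ≤ v) ⊆ insert x (R.filter (· < x)) →
      ∃ l : List α, l <+ x :: L ∧ l.Pairwise (· > ·) ∧ (∀ a ∈ l, a ≤ v) ∧
        (R'.filter (· ≤ v)).card ≤ l.length := by
    intro R R' L x v ih hxv hsub
    have hlt : ∃ l : List α, l <+ L ∧ l.Pairwise (· > ·) ∧ (∀ a ∈ l, a < x) ∧
        (R.filter (· < x)).card ≤ l.length := by
      rcases (R.filter (· < x)).eq_empty_or_nonempty with he | hne
      · exact ⟨[], by simp, by simp, by simp, by simp [he]⟩
      · have hm := Finset.mem_filter.mp (Finset.max'_mem _ hne)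
        obtain ⟨l, h1, h2, h3, h4⟩ := ih (Finset.max' _ hne)
        refine ⟨l, h1, h2, fun a ha => (h3 a ha).trans_lt hm.2,
          (Finset.card_le_card fun r hr => ?_).trans h4⟩
        exact Finset.mem_filter.mpr ⟨(Finset.mem_filter.mp hr).1, Finset.le_max' _ _ hr⟩
    obtain ⟨l, h1, h2, h3, h4⟩ := hlt
    refine ⟨x :: l, h1.cons_cons x, List.pairwise_cons.mpr ⟨h3, h2⟩, ?_, ?_⟩
    · intro a ha
      rcases List.mem_cons.mp ha with h | h
      · exact h ▸ hxv
      · exact (h3 a h).le.trans hxv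
    · exact (Finset.card_le_card hsub).trans ((Finset.card_insert_le _ _).trans (by simpa using h4))
  have skip_step : ∀ {R R' : Finset α} {L : List α} {x v : α},
      (∀ v : α, ∃ l : List α, l <+ L ∧ l.Pairwise (· > ·) ∧ (∀ a ∈ l, a ≤ v) ∧
        (R.filter (· ≤ v)).card ≤ l.length) →
      (R'.filter (· ≤ v)).card ≤ (R.filter (· ≤ v)).card →
      ∃ l : List α, l <+ x :: L ∧ l.Pairwise (· > ·) ∧ (∀ a ∈ l, a ≤ v) ∧
        (R'.filter (· ≤ v)).card ≤ l.length := by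
    intro R R' L x v ih hle
    obtain ⟨l, h1, h2, h3, h4⟩ := ih v
    exact ⟨l, h1.cons x, h2, h3, hle.trans h4⟩
  induction h with
  | nil R =>
    intro v
    refine ⟨l₀.filter (· ≤ v), by simp, h₀.filter _, by simp, ?_⟩
    rw [← hR, ← List.toFinset_card_of_nodup ((h₀.filter _).imp fun h => ne_of_gt h)]
    exact Finset.card_le_card fun a ha => by simpa using ha
  | @append W R₀ R xs bs x h hx ih =>
    intro v
    by_cases hxv : x ≤ v
    · refine cons_step (ih hR) hxv fun r hr => ?_
      rcases Finset.mem_insert.mp (Finset.mem_filter.mp hr).1 with h1 | h1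
      · exact h1 ▸ Finset.mem_insert_self _ _
      · exact Finset.mem_insert_of_mem (Finset.mem_filter.mpr ⟨h1, hx r h1⟩)
    · refine skip_step (ih hR) ?_
      rw [Finset.filter_insert, if_neg hxv]
  | @bump W R₀ R xs bs x b h hx hb hxb hmin ih =>
    intro v
    by_cases hbv : b ≤ v
    · refine skip_step (ih hR) ?_
      rw [Finset.filter_insert, if_pos (hxb.le.trans hbv), Finset.filter_erase,
          Finset.card_insert_of_notMem (by simp [hx]),
          Finset.card_erase_add_one (Finset.mem_filter.mpr ⟨hb, hbv⟩)]
    by_cases hxv : x ≤ v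
    · refine cons_step (ih hR) hxv fun r hr => ?_
      obtain ⟨h1, h2⟩ := Finset.mem_filter.mp hr
      rcases Finset.mem_insert.mp h1 with h1 | h1
      · exact h1 ▸ Finset.mem_insert_self _ _
      · have h1 := Finset.mem_of_mem_erase h1
        refine Finset.mem_insert_of_mem (Finset.mem_filter.mpr ⟨h1, ?_⟩)
        rcases lt_trichotomy r x with h3 | h3 | h3
        · exact h3
        · exact absurd (h3 ▸ h1) hx
        · exact absurd ((hmin r h1 h3).trans h2) hbv
    · refine skip_step (ih hR) ?_
      rw [Finset.filter_insert, if_neg hxv]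
      exact Finset.card_le_card (Finset.filter_subset_filter _ (Finset.erase_subset _ _))

open List in
/-- Schensted: the final row is as long as the longest monotone subsequence. -/
theorem isGreatest_card_row (h : RowInsertion W l₀.toFinset xs R bs)
    (h₀ : l₀.Pairwise (· > ·)) :
    IsGreatest {m | ∃ l : List α, l <+ xs ++ l₀ ∧ l.Pairwise (· > ·) ∧ l.length = m} R.card := by
  have upper : ∀ l : List α, l <+ xs ++ l₀ → l.Pairwise (· > ·) → l.length ≤ R.card := by
    intro l hl hp
    cases l with
    | nil => simp
    | cons c t =>
      refine (h.length_le_card_filter c _ hl hp ?_).trans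
        (Finset.card_le_card (Finset.filter_subset _ _))
      intro a ha
      rcases List.mem_cons.mp ha with h | h
      · exact h.le
      · exact ((List.pairwise_cons.mp hp).1 a h).le
  constructor
  · rcases R.eq_empty_or_nonempty with he | hne
    · exact ⟨[], by simp, by simp, by simp [he]⟩
    · obtain ⟨l, h1, h2, -, h4⟩ := h.exists_card_filter_le_length h₀ (R.max' hne)
      rw [Finset.filter_true_of_mem fun r hr => Finset.le_max' _ _ hr] at h4
      exact ⟨l, h1, h2, le_antisymm (upper l h1 h2) h4⟩
  · rintro m ⟨l, h1, h2, rfl⟩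
    exact upper l h1 h2

end RowInsertion

section Words

/-- The Boolean words of length `k`. -/
def boolWords : ℕ → Finset (List Bool)
  | 0 => {[]}
  | k + 1 => (boolWords k).image (List.cons true) ∪ (boolWords k).image (List.cons false)

theorem mem_boolWords {k : ℕ} {W : List Bool} : W ∈ boolWords k ↔ W.length = k := by
  induction k generalizing W with
  | zero => simp [boolWords]
  | succ k ih =>
    cases W with
    | nil => simp [boolWords]
    | cons a W => cases a <;> simp [boolWords, ih]

theorem sum_boolWords (k : ℕ) (y : ℕ → ℕ) :
    ∑ W ∈ boolWords k, y (W.count true) = ∑ s ∈ Finset.range (k + 1), k.choose s * y s := by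
  induction k generalizing y with
  | zero => simp [boolWords]
  | succ k ih =>
    have hd : Disjoint ((boolWords k).image (List.cons true))
        ((boolWords k).image (List.cons false)) := by
      rw [Finset.disjoint_left]
      simp
    rw [boolWords, Finset.sum_union hd, Finset.sum_image (by simp),
      Finset.sum_image (by simp)]
    simp only [List.count_cons_self, List.count_cons_of_ne (Bool.false_ne_true)]
    rw [ih y, ih fun s => y (s + 1), Finset.sum_range_succ' _ (k + 1)]
    simp only [Nat.choose_succ_succ, add_mul, Finset.sum_add_distrib, Nat.choose_zero_right]
    rw [add_assoc, Finset.sum_range_succ (fun s => k.choose (s + 1) * y (s + 1)) k,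
      Finset.sum_range_succ' (fun s => k.choose s * y s) k]
    simp

end Words

section Counting

open List in
theorem hasIncSubseq_iff_exists_sublist {n m : ℕ} (w : Equiv.Perm (Fin n)) :
    HasIncSubseq w m ↔
      ∃ l : List (Fin n), l <+ List.ofFn w ∧ l.Pairwise (· < ·) ∧ l.length = m := by
  constructor
  · rintro ⟨f, hf, hwf⟩
    refine ⟨List.ofFn fun j => w (f j), ?_, ?_, by simp⟩
    · rw [List.ofFn_eq_map (f := w), List.sublist_map_iff]
      refine ⟨List.ofFn f, ?_, by rw [List.map_ofFn]; rfl⟩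
      refine List.sublist_of_subperm_of_pairwise (r := (· ≤ ·)) ?_ ?_ ?_
      · exact List.subperm_of_subset (List.nodup_ofFn.mpr hf.injective)
          fun a _ => List.mem_finRange a
      · exact List.pairwise_ofFn.mpr fun i j hij => (hf hij).le
      · exact (List.pairwise_lt_finRange n).imp le_of_lt
    · exact List.pairwise_ofFn.mpr fun i j hij => hwf hij
  · rintro ⟨l, hl, hp, rfl⟩
    rw [List.ofFn_eq_map, List.sublist_map_iff] at hl
    obtain ⟨l', hl', rfl⟩ := hl
    rw [List.pairwise_map, List.pairwise_iff_get] at hp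
    have hs := (List.pairwise_lt_finRange n).sublist hl'
    rw [List.pairwise_iff_get] at hs
    refine ⟨fun j => l'.get (j.cast (by simp)), ?_, ?_⟩
    · intro i j hij
      exact hs _ _ hij
    · intro i j hij
      exact hp _ _ hij

/-- The values of `w`, listed from the last position to the first. -/
def revWord {n : ℕ} (w : Equiv.Perm (Fin n)) : List (Fin n) :=
  (List.ofFn w).reverse

theorem length_revWord {n : ℕ} (w : Equiv.Perm (Fin n)) : (revWord w).length = n := by
  simp [revWord]

theorem nodup_revWord {n : ℕ} (w : Equiv.Perm (Fin n)) : (revWord w).Nodup :=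
  List.nodup_reverse.mpr (List.nodup_ofFn.mpr w.injective)

theorem mem_revWord {n : ℕ} (w : Equiv.Perm (Fin n)) (a : Fin n) : a ∈ revWord w := by
  rw [revWord, List.mem_reverse, List.mem_ofFn]
  exact w.surjective a

theorem coe_revWord {n : ℕ} (w : Equiv.Perm (Fin n)) :
    (revWord w : Multiset (Fin n)) = Finset.univ.1 :=
  (Multiset.Nodup.ext (Multiset.coe_nodup.mpr (nodup_revWord w)) Finset.univ.2).mpr fun a => by simp [mem_revWord]

theorem revWord_injective {n : ℕ} :
    Function.Injective (revWord : Equiv.Perm (Fin n) → List (Fin n)) := fun _ _ h =>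
  DFunLike.coe_injective (List.ofFn_injective (List.reverse_injective h))

theorem exists_revWord_eq {n : ℕ} (L : List (Fin n))
    (hL : (L : Multiset (Fin n)) = Finset.univ.1) : ∃ w, revWord w = L := by
  have hlen : L.reverse.length = n := by
    simpa using congrArg Multiset.card hL
  have hnd : L.reverse.Nodup := by
    rw [List.nodup_reverse, ← Multiset.coe_nodup, hL]
    exact Finset.univ.2
  have hinj : Function.Injective fun i : Fin n => L.reverse.get (i.cast hlen.symm) := by
    intro i j hij
    simpa using List.nodup_iff_injective_get.mp hnd hij
  refine ⟨Equiv.ofBijective _ (Finite.injective_iff_bijective.mp hinj), ?_⟩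
  rw [revWord, List.reverse_eq_iff]
  apply List.ext_getElem <;> simp [hlen]

open List in
theorem isLen_eq_of_isGreatest {n c : ℕ} (w : Equiv.Perm (Fin n))
    (h : IsGreatest {m | ∃ l : List (Fin n), l <+ revWord w ∧ l.Pairwise (· > ·) ∧
      l.length = m} c) : isLen w = c := by
  rw [isLen, ← h.csSup_eq]
  congr 1
  ext m
  rw [Set.mem_ofPred_eq, hasIncSubseq_iff_exists_sublist, Set.mem_ofPred_eq]
  constructor
  · rintro ⟨l, h1, h2, h3⟩
    exact ⟨l.reverse, h1.reverse, List.pairwise_reverse.mpr h2, by simpa using h3⟩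
  · rintro ⟨l, h1, h2, h3⟩
    refine ⟨l.reverse, ?_, List.pairwise_reverse.mpr h2, by simpa using h3⟩
    simpa [revWord] using h1.reverse

theorem prefixInc_iff_pairwise_drop_revWord {n s : ℕ} (w : Equiv.Perm (Fin n)) :
    PrefixInc n s w ↔ ((revWord w).drop s).Pairwise (· > ·) := by
  rw [revWord, List.drop_reverse, List.pairwise_reverse, List.pairwise_iff_getElem]
  simp only [List.length_take, List.length_ofFn, List.getElem_take, List.getElem_ofFn]
  constructor
  · intro h i j hi hj hij
    exact h _ _ hij (by simpa using (lt_min_iff.mp hj).1)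
  · intro h i j hij hj
    exact h i j (by omega) (by omega) hij

/-- The lists whose row insertion, starting from the complementary row, has pattern `W`. -/
def insertionLists (n : ℕ) (W : List Bool) : Set (List (Fin n)) :=
  {xs | ∃ R₀ R bs, R₀.1 + (xs : Multiset (Fin n)) = Finset.univ.1 ∧ RowInsertion W R₀ xs R bs}

/-- The lists of length `s` that can be reverse bumped into the complementary row. -/
def reverseBumpableLists (n s : ℕ) : Set (List (Fin n)) :=
  {bs | bs.length = s ∧ ∃ R : Finset (Fin n),
    R.1 + (bs : Multiset (Fin n)) = Finset.univ.1 ∧ ReverseBumpable R bs}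

theorem finset_eq_of_val_add_eq {n : ℕ} {R R' : Finset (Fin n)} {l : Multiset (Fin n)}
    (h : R.1 + l = Finset.univ.1) (h' : R'.1 + l = Finset.univ.1) : R = R' :=
  Finset.val_injective (add_right_cancel (h.trans h'.symm))

theorem ncard_insertionLists {n : ℕ} (W : List Bool) (hW : 2 * W.length ≤ n) :
    (insertionLists n W).ncard = (reverseBumpableLists n (W.count true)).ncard := by
  have hcount := List.count_true_add_count_false W
  have hcard : ∀ (R : Finset (Fin n)) (l : List (Fin n)),
      R.1 + (l : Multiset (Fin n)) = Finset.univ.1 → R.card + l.length = n := by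
    intro R l h
    simpa using congrArg Multiset.card h
  have hbs : ∀ xs ∈ insertionLists n W, ∃ R₀ bs R,
      R₀.1 + (xs : Multiset (Fin n)) = Finset.univ.1 ∧ RowInsertion W R₀ xs R bs :=
    fun xs ⟨R₀, R, bs, h⟩ => ⟨R₀, bs, R, h⟩
  choose R₀ f R hR₀ hf using hbs
  have hR : ∀ xs hxs, (R xs hxs).1 + (f xs hxs : Multiset (Fin n)) = Finset.univ.1 :=
    fun xs hxs => (hf xs hxs).val_add_eq.trans (hR₀ xs hxs)
  refine Set.ncard_congr f ?_ ?_ ?_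
  · intro xs hxs
    refine ⟨(hf xs hxs).length_bs, R xs hxs, hR xs hxs, (hf xs hxs).reverseBumpable ?_ ?_⟩
    · rw [hR₀]
      exact Finset.univ.2
    · have h1 := hcard _ _ (hR₀ xs hxs)
      have h2 := (hf xs hxs).length_xs
      have h3 := (hf xs hxs).length_bs
      omega
  · intro xs xs' hxs hxs' heq
    have h1 := hf xs hxs
    have h2 := hf xs' hxs'
    have h3 := hR xs hxs
    rw [heq] at h1 h3
    rw [finset_eq_of_val_add_eq h3 (hR xs' hxs')] at h1
    exact h1.left_unique h2
  · rintro bs ⟨hlen, R', hR', hV⟩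
    have hc := hcard _ _ hR'
    obtain ⟨R₁, xs, h⟩ := RowInsertion.exists_of_reverseBumpable W R' bs
      (by rw [hR']; exact Finset.univ.2) hlen (by omega) hV
    have hR₁ := h.val_add_eq.symm.trans hR'
    have hxs : xs ∈ insertionLists n W := ⟨R₁, R', bs, hR₁, h⟩
    refine ⟨xs, hxs, ?_⟩
    have h' := hf xs hxs
    rw [finset_eq_of_val_add_eq (hR₀ xs hxs) hR₁] at h'
    exact (h'.right_unique h).2.2

theorem ncard_nodup_lists (n k : ℕ) :
    {xs : List (Fin n) | xs.Nodup ∧ xs.length = k}.ncard = n.descFactorial k := by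
  have h1 : n.descFactorial k = (Set.univ : Set (Fin k ↪ Fin n)).ncard := by
    rw [Set.ncard_univ, Nat.card_eq_fintype_card, Fintype.card_embedding_eq,
      Fintype.card_fin, Fintype.card_fin]
  rw [h1]
  symm
  refine Set.ncard_congr (fun e _ => List.ofFn e) ?_ ?_ ?_
  · intro e _
    exact ⟨List.nodup_ofFn.mpr e.injective, by simp⟩
  · intro e e' _ _ h
    exact DFunLike.coe_injective (List.ofFn_injective h)
  · rintro xs ⟨hnd, rfl⟩
    exact ⟨⟨xs.get, List.nodup_iff_injective_get.mp hnd⟩, trivial, List.ofFn_get xs⟩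

theorem sum_ncard_insertionLists (n k : ℕ) :
    ∑ W ∈ boolWords k, (insertionLists n W).ncard = n.descFactorial k := by
  have hset : {xs : List (Fin n) | xs.Nodup ∧ xs.length = k} =
      ⋃ W ∈ (boolWords k : Set (List Bool)), insertionLists n W := by
    ext xs
    simp only [Set.mem_ofPred_eq, Set.mem_iUnion, Finset.mem_coe, mem_boolWords, exists_prop]
    constructor
    · rintro ⟨hnd, hlen⟩
      have hle : (xs : Multiset (Fin n)) ≤ Finset.univ.1 :=
        (Multiset.le_iff_subset (by simpa using hnd)).mpr fun a _ => Finset.mem_univ a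
      have h : (xs.toFinsetᶜ).1 + (xs : Multiset (Fin n)) = Finset.univ.1 := by
        rw [Finset.compl_eq_univ_sdiff, Finset.sdiff_val, List.toFinset_val, hnd.dedup,
          tsub_add_cancel_of_le hle]
      obtain ⟨W, R, bs, hW⟩ := RowInsertion.exists_of_nodup (xs.toFinsetᶜ) xs
        (by rw [h]; exact Finset.univ.2)
      exact ⟨W, hW.length_xs.symm.trans hlen, _, _, _, h, hW⟩
    · rintro ⟨W, hlen, R₀, R, bs, h, hW⟩
      refine ⟨?_, hW.length_xs.trans hlen⟩
      have : (R₀.1 + (xs : Multiset (Fin n))).Nodup := by rw [h]; exact Finset.univ.2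
      simpa using (Multiset.nodup_add.mp this).2.1
  have hfin : {xs : List (Fin n) | xs.Nodup ∧ xs.length = k}.Finite :=
    (List.finite_length_eq (Fin n) k).subset fun xs h => h.2
  rw [← ncard_nodup_lists, hset, Set.Finite.ncard_biUnion (Finset.finite_toSet _)]
  · exact (finsum_mem_coe_finset _ _).symm
  · intro W hW
    refine hfin.subset ?_
    rw [hset]
    exact Set.subset_biUnion_of_mem (u := fun W => insertionLists n W) hW
  · intro W _ W' _ hne
    rw [Function.onFun, Set.disjoint_left]
    rintro xs ⟨R₀, R, bs, h, hW⟩ ⟨R₀', R', bs', h', hW'⟩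
    obtain rfl := finset_eq_of_val_add_eq h h'
    exact hne (hW.right_unique hW').1

theorem card_PiFinset {n s : ℕ} (hs : s ≤ n) :
    (PiFinset n s).card = (insertionLists n (List.replicate s true)).ncard := by
  classical
  have mem_iff : ∀ w : Equiv.Perm (Fin n),
      w ∈ PiFinset n s ↔ PrefixInc n s w ∧ isLen w = n - s := fun w => by simp [PiFinset]
  have isLen_iff : ∀ (w : Equiv.Perm (Fin n)) (xs l₀ : List (Fin n)) (W : List Bool)
      (R : Finset (Fin n)) (bs : List (Fin n)), xs ++ l₀ = revWord w → xs.length = s →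
      l₀.Pairwise (· > ·) → RowInsertion W l₀.toFinset xs R bs →
      (isLen w = n - s ↔ W = List.replicate s true) := by
    intro w xs l₀ W R bs hw hxs hl₀ hW
    have h1 := hW.isGreatest_card_row hl₀
    rw [hw] at h1
    have h2 := hW.card_row
    rw [List.toFinset_card_of_nodup (hl₀.imp fun h => ne_of_gt h)] at h2
    have h3 := congrArg List.length hw
    rw [List.length_append, length_revWord] at h3
    rw [isLen_eq_of_isGreatest w h1, List.eq_replicate_iff]
    have h4 : R.card = n - s ↔ W.count false = 0 := by omega
    rw [h4, List.count_eq_zero]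
    constructor
    · intro h
      refine ⟨hW.length_xs.symm.trans hxs, fun b hb => ?_⟩
      cases b with
      | false => exact absurd hb h
      | true => rfl
    · rintro ⟨-, h⟩ hmem
      exact Bool.false_ne_true (h _ hmem)
  rw [← Set.ncard_coe_finset]
  refine Set.ncard_congr (fun w _ => (revWord w).take s) ?_ ?_ ?_
  · intro w hw
    obtain ⟨hpre, hlen⟩ := (mem_iff w).mp hw
    rw [prefixInc_iff_pairwise_drop_revWord] at hpre
    have hval : ((revWord w).drop s).toFinset.1 + ((revWord w).take s : Multiset (Fin n)) =
        Finset.univ.1 := by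
      rw [List.toFinset_val, List.Nodup.dedup (hpre.imp fun h => ne_of_gt h), add_comm,
        Multiset.coe_add, List.take_append_drop, coe_revWord]
    obtain ⟨W, R, bs, hW⟩ := RowInsertion.exists_of_nodup _ _
      (by rw [hval]; exact Finset.univ.2)
    have := (isLen_iff w _ _ W R bs (List.take_append_drop s (revWord w))
      (by simp [length_revWord, hs]) hpre hW).mp hlen
    subst this
    exact ⟨_, _, _, hval, hW⟩
  · intro w w' hw hw' heq
    have hpre := (mem_iff w).mp hw |>.1
    have hpre' := (mem_iff w').mp hw' |>.1
    rw [prefixInc_iff_pairwise_drop_revWord] at hpre hpre'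
    apply revWord_injective
    have hperm : (revWord w).Perm (revWord w') :=
      Multiset.coe_eq_coe.mp ((coe_revWord w).trans (coe_revWord w').symm)
    rw [← List.take_append_drop s (revWord w), ← List.take_append_drop s (revWord w')] at hperm ⊢
    rw [heq] at hperm ⊢
    rw [List.perm_append_left_iff] at hperm
    rw [List.Perm.eq_of_pairwise (fun a b _ _ h h' => absurd h (lt_asymm h')) hpre hpre' hperm]
  · rintro xs ⟨R₀, R, bs, h, hW⟩
    have hxs : xs.length = s := by simpa using hW.length_xs
    set l₀ := R₀.sort (· ≥ ·) with hl₀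
    have hval : (l₀ : Multiset (Fin n)) = R₀.1 := Finset.sort_eq R₀ _
    have hnd : l₀.Nodup := by
      rw [← Multiset.coe_nodup, hval]
      exact R₀.2
    have hp : l₀.Pairwise (· > ·) :=
      ((Finset.pairwise_sort R₀ (· ≥ ·)).and hnd).imp fun h => lt_of_le_of_ne h.1 h.2.symm
    have hfs : l₀.toFinset = R₀ := Finset.val_injective (by
      rw [List.toFinset_val, hnd.dedup, hval])
    obtain ⟨w, hw⟩ := exists_revWord_eq (xs ++ l₀) (by
      rw [← Multiset.coe_add, hval, add_comm, h])
    refine ⟨w, (mem_iff w).mpr ⟨?_, ?_⟩, ?_⟩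
    · rw [prefixInc_iff_pairwise_drop_revWord, hw, List.drop_left' hxs]
      exact hp
    · exact (isLen_iff w xs l₀ _ R bs hw.symm hxs hp (hfs.symm ▸ hW)).mpr rfl
    · simp only [hw, List.take_left' hxs]

end Counting

/-- Recurrence: for `n >= 2k`,
`sum_{s=0}^{k} C(k,s) #Pi_{n,s} = C(n,k) k! = n!/(n-k)!`. -/
theorem pi_recurrence (n k : ℕ) (h : 2 * k ≤ n) :
    (∑ s ∈ Finset.range (k + 1), k.choose s * (PiFinset n s).card
        = n.choose k * k.factorial) ∧
      n.choose k * k.factorial = n.factorial / (n - k).factorial := by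
  have hd : n.choose k * k.factorial = n.descFactorial k := by
    rw [Nat.descFactorial_eq_factorial_mul_choose, mul_comm]
  refine ⟨?_, by rw [hd, Nat.descFactorial_eq_div (by omega)]⟩
  rw [hd, ← sum_ncard_insertionLists, Finset.sum_congr rfl fun W hW =>
    ncard_insertionLists W (by rw [mem_boolWords.mp hW]; exact h),
    sum_boolWords k fun s => (reverseBumpableLists n s).ncard]
  refine Finset.sum_congr rfl fun s hs => ?_
  have hsk := Finset.mem_range.mp hs
  rw [card_PiFinset (by omega), ncard_insertionLists _ (by rw [List.length_replicate]; omega),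
    List.count_replicate_self]
end
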